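/- Let n ≥ 1, Q = 2n+2, Q' = Q/(Q−1), and let r > 0 be given. Let 0 ≤ β < Q and 0 ≤ α ≤ α_Q(1 − β/Q). Then there exists a constant C depending only on n, r and β (in particular, independent of the center ξ₀) such that for every ξ₀ ∈ ℍ^n and every w ∈ C_c^∞(ℝ^{2n+1}) vanishing outside B_h(ξ₀,r) with ∫_{B_h(ξ₀,r)} |∇_H w|^Q dξ ≤ 1, one has ∫_{B_h(ξ₀,r)} |ξ|_h^{−β} ζ(Q, α|w|^{Q'}) dξ ≤ C ∫_{B_h(ξ₀,r)} |∇_H w|^Q dξ. -/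

import Mathlib

open MeasureTheory Real ENNReal

noncomputable section

/-- The Heisenberg group `ℍ^n` as the underlying space `ℝ^n × ℝ^n × ℝ`. -/
abbrev Heis (n : ℕ) := (Fin n → ℝ) × (Fin n → ℝ) × ℝ

/-- Heisenberg group law: `(x,y,t)∘(x',y',t') = (x+x', y+y', t+t'+2(⟨y,x'⟩−⟨x,y'⟩))`. -/
def hMul {n : ℕ} (ξ η : Heis n) : Heis n :=
  (ξ.1 + η.1, ξ.2.1 + η.2.1,
    ξ.2.2 + η.2.2 + 2 * ((∑ i, ξ.2.1 i * η.1 i) - ∑ i, ξ.1 i * η.2.1 i))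

/-- Homogeneous norm `|ξ|_h = ((|x|²+|y|²)² + t²)^{1/4}`. -/
def hNorm {n : ℕ} (ξ : Heis n) : ℝ :=
  ((∑ i, ((ξ.1 i) ^ 2 + (ξ.2.1 i) ^ 2)) ^ 2 + (ξ.2.2) ^ 2) ^ ((1 : ℝ) / 4)

/-- Heisenberg distance `d_h(ξ,η) = |η⁻¹∘ξ|_h`, where `η⁻¹ = -η`. -/
def hDist {n : ℕ} (ξ η : Heis n) : ℝ := hNorm (hMul (-η) ξ)

/-- Heisenberg ball `B_h(ξ,r) = {η : d_h(η,ξ) < r}`. -/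
def hBall {n : ℕ} (ξ : Heis n) (r : ℝ) : Set (Heis n) := {η | hDist η ξ < r}

/-- Left-invariant vector field `X_i u = ∂u/∂x_i + 2 y_i ∂u/∂t`. -/
def Xd {n : ℕ} (u : Heis n → ℝ) (i : Fin n) (ξ : Heis n) : ℝ :=
  fderiv ℝ u ξ (Pi.single i 1, 0, 0) + 2 * ξ.2.1 i * fderiv ℝ u ξ (0, 0, 1)

/-- Left-invariant vector field `Y_i u = ∂u/∂y_i − 2 x_i ∂u/∂t`. -/
def Yd {n : ℕ} (u : Heis n → ℝ) (i : Fin n) (ξ : Heis n) : ℝ :=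
  fderiv ℝ u ξ (0, Pi.single i 1, 0) - 2 * ξ.1 i * fderiv ℝ u ξ (0, 0, 1)

/-- Norm of the sub-elliptic gradient `|∇_H u| = (Σ ((X_i u)² + (Y_i u)²))^{1/2}`. -/
def hGradNorm {n : ℕ} (u : Heis n → ℝ) (ξ : Heis n) : ℝ :=
  Real.sqrt (∑ i, ((Xd u i ξ) ^ 2 + (Yd u i ξ) ^ 2))

/-- `ζ(Q,s) = e^s − Σ_{k=0}^{Q−2} s^k/k!`. -/
def zeta (Q : ℕ) (s : ℝ) : ℝ :=
  Real.exp s - ∑ k ∈ Finset.range (Q - 1), s ^ k / (Nat.factorial k)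

/-- Surface area of the unit sphere in `ℝ^{2n}`: `ω_{2n-1} = 2π^n/(n-1)!`. -/
def omegaSphere (n : ℕ) : ℝ := 2 * Real.pi ^ n / (Nat.factorial (n - 1))

/-- `σ_Q = Γ(1/2) Γ(n+1/2) ω_{2n-1} / n!`. -/
def sigmaQ (n : ℕ) : ℝ :=
  Real.Gamma (1 / 2) * Real.Gamma (n + 1 / 2) * omegaSphere n / (Nat.factorial n)

/-- `α_Q = Q σ_Q^{1/(Q-1)}` with `Q = 2n+2`. -/
def alphaQ (n : ℕ) : ℝ := (2 * n + 2) * (sigmaQ n) ^ ((1 : ℝ) / (2 * n + 1))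

/-- Hölder's inequality for a sum of two products, in the form used for pieces of an integral. -/
theorem two_term_holder {p q : ℝ} (hpq : q.HolderConjugate p) {a b u v : ℝ}
    (ha : 0 ≤ a) (hb : 0 ≤ b) (hu : 0 ≤ u) (hv : 0 ≤ v) :
    u ^ (1 / q) * a ^ (1 / p) + v ^ (1 / q) * b ^ (1 / p) ≤
      (u + v) ^ (1 / q) * (a + b) ^ (1 / p) := by
  have hq := hpq.ne_zero
  have hp := hpq.symm.ne_zero
  have h := Real.inner_le_Lp_mul_Lq_of_nonneg (Finset.univ : Finset (Fin 2)) hpq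
    (f := ![u ^ (1 / q), v ^ (1 / q)]) (g := ![a ^ (1 / p), b ^ (1 / p)])
    (by intro i _; fin_cases i <;> simp <;> positivity)
    (by intro i _; fin_cases i <;> simp <;> positivity)
  simpa [Fin.sum_univ_two, ← Real.rpow_mul, ha, hb, hu, hv, hq, hp] using h

/-- `S ^ q` is controlled by `x * y ^ (q - 1)` once `S` is controlled by the Hölder product. -/
theorem rpow_le_of_le_holder_prod {p q : ℝ} (hpq : q.HolderConjugate p) {S x y : ℝ} (hS : 0 ≤ S)
    (hx : 0 ≤ x) (hy : 0 ≤ y) (h : S ≤ x ^ (1 / q) * y ^ (1 / p)) : S ^ q ≤ x * y ^ (q - 1) := by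
  have hq := hpq.pos
  have hp := hpq.symm.pos
  have h1 : S ^ q ≤ (x ^ (1 / q) * y ^ (1 / p)) ^ q := Real.rpow_le_rpow hS h hq.le
  rw [Real.mul_rpow (by positivity) (by positivity), ← Real.rpow_mul hx, ← Real.rpow_mul hy] at h1
  have h2 : 1 / p * q = q - 1 := by
    have := hpq.sub_one_mul_conj
    field_simp; linarith
  have h3 : 1 / q * q = 1 := by field_simp
  rwa [h2, h3, Real.rpow_one] at h1

/-- If `S` is nearly extremal at `y`, then the mass `e` carried beyond `y` is `O(N / y)`. -/
theorem tail_mass_le {p q : ℝ} (hpq : q.HolderConjugate p) (hq2 : q ≤ 2) {K S e y N : ℝ}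
    (hK : 0 ≤ K) (hS : 0 ≤ S) (he0 : 0 ≤ e) (he1 : e ≤ 1) (hy : 0 ≤ y) (hN : 1 ≤ N)
    (h1 : S ≤ y ^ (1 / q) * (1 - e) ^ (1 / p) + K * e ^ (1 / p)) (h2 : y - N ≤ S ^ q) :
    e * y ≤ 2 * (1 + K ^ q * 2 ^ (q - 1)) / (q - 1) * N := by
  have hq := hpq.pos
  have hq1 : 0 < q - 1 := by linarith [hpq.lt]
  have hp := hpq.symm.pos
  have hpq1 : q - 1 = q / p := by
    have := hpq.sub_one_mul_conj
    field_simp; linarith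
  set v := K ^ q * 2 ^ (q - 1) with hv
  have hv0 : 0 ≤ v := by positivity
  have h3 : K * e ^ (1 / p) = v ^ (1 / q) * (e / 2) ^ (1 / p) := by
    rw [hv, Real.mul_rpow (by positivity) (by positivity), ← Real.rpow_mul hK,
      ← Real.rpow_mul (by norm_num), Real.div_rpow he0 (by norm_num), hpq1]
    have e1 : q * (1 / q) = 1 := by field_simp
    have e2 : q / p * (1 / q) = 1 / p := by field_simp
    rw [e1, e2, Real.rpow_one]
    field_simp
  have h4 : S ≤ (y + v) ^ (1 / q) * (1 - e / 2) ^ (1 / p) := by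
    have := two_term_holder hpq (a := 1 - e) (b := e / 2) (u := y) (v := v) (by linarith)
      (by linarith) hy hv0
    rw [show 1 - e + e / 2 = 1 - e / 2 by ring] at this
    linarith
  have h5 := rpow_le_of_le_holder_prod hpq hS (by positivity) (by linarith) h4
  have h6 : (1 - e / 2) ^ (q - 1) ≤ 1 + (q - 1) * (- (e / 2)) := by
    have := rpow_one_add_le_one_add_mul_self (s := -(e / 2)) (by linarith) hq1.le
      (by linarith)
    rwa [← sub_eq_add_neg] at this
  have h7 : y - N ≤ (y + v) * (1 + (q - 1) * (- (e / 2))) :=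
    h2.trans (h5.trans (by gcongr))
  rw [div_mul_eq_mul_div, le_div_iff₀ hq1]
  have : 0 ≤ v * (e * (q - 1)) := by positivity
  nlinarith

/-- Two nearly extremal points `y₁ < y₂` that are not too small are at distance `O(N)`. -/
theorem near_extremal_dist_le {p q : ℝ} (hpq : q.HolderConjugate p) (hq2 : q ≤ 2)
    {K S e y₁ y₂ N b c : ℝ} (hK : 0 ≤ K) (hS : 0 ≤ S) (he0 : 0 ≤ e) (hc : 0 ≤ c)
    (hN : 1 ≤ N) (he : e * y₁ ≤ c * N) (hb : b = 4 ^ (p - 1) * ((1 + K) ^ p * c))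
    (hy : 0 < y₁) (hy1 : b * N ≤ y₁) (hy12 : y₁ ≤ y₂)
    (h1 : S ≤ y₁ ^ (1 / q) + e ^ (1 / p) * ((y₂ - y₁) ^ (1 / q) + K)) (h2 : y₂ - N ≤ S ^ q) :
    y₂ - y₁ ≤ 2 * (1 + b) * N := by
  have hq := hpq.pos
  have hq1 : 0 < q - 1 := by linarith [hpq.lt]
  have hp := hpq.symm.pos
  have hp1 : 0 < p - 1 := by linarith [hpq.symm.lt]
  have hb0 : 0 ≤ b := by rw [hb]; positivity
  obtain ⟨D, rfl⟩ : ∃ D, y₂ = y₁ + D := ⟨y₂ - y₁, by ring⟩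
  rw [add_sub_cancel_left] at *
  have hbN : 0 ≤ b * N := by positivity
  rcases le_total D 1 with hD | hD
  · nlinarith
  have hD1 : 1 ≤ D ^ (1 / q) := Real.one_le_rpow hD (by positivity)
  have h3 : e ^ (1 / p) * (D ^ (1 / q) + K) ≤
      (D / 4) ^ (1 / q) * (b * N / y₁) ^ (1 / p) := by
    have e1 : e ≤ c * N / y₁ := by rwa [le_div_iff₀ hy]
    have e2 : (D / 4) ^ (1 / q) * (b * N / y₁) ^ (1 / p) =
        (c * N / y₁) ^ (1 / p) * ((1 + K) * D ^ (1 / q)) := by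
      rw [show b * N / y₁ = 4 ^ (p - 1) * ((1 + K) ^ p * (c * N / y₁)) by rw [hb]; ring,
        Real.mul_rpow (by positivity) (by positivity), Real.mul_rpow (by positivity) (by positivity),
        Real.div_rpow (by positivity) (by norm_num), ← Real.rpow_mul (by norm_num),
        ← Real.rpow_mul (by positivity)]
      have e3 : (p - 1) * (1 / p) = 1 / q := by
        have := hpq.symm.sub_one_mul_conj
        field_simp; linarith
      have e4 : p * (1 / p) = 1 := by field_simp
      rw [e3, e4, Real.rpow_one]
      field_simp
    rw [e2]
    gcongr
    nlinarith
  have h4 : S ≤ (y₁ + D / 4) ^ (1 / q) * (1 + b * N / y₁) ^ (1 / p) := by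
    have := two_term_holder hpq (a := 1) (b := b * N / y₁) (u := y₁) (v := D / 4) (by norm_num)
      (by positivity) hy.le (by linarith)
    rw [Real.one_rpow, mul_one] at this
    linarith
  have h5 := rpow_le_of_le_holder_prod hpq hS (by positivity) (by positivity) h4
  have h6 : (1 + b * N / y₁) ^ (q - 1) ≤ 1 + b * N / y₁ := by
    have := Real.rpow_le_rpow_of_exponent_le (x := 1 + b * N / y₁) (y := q - 1) (z := 1)
      (by linarith [show 0 ≤ b * N / y₁ by positivity]) (by linarith)
    rwa [Real.rpow_one] at this
  have h7 : y₁ + D - N ≤ (y₁ + D / 4) * (1 + b * N / y₁) :=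
    h2.trans (h5.trans (by gcongr))
  have h8 : y₁ * (b * N / y₁) = b * N := by field_simp
  have h9 : b * N / y₁ ≤ 1 := by rwa [div_le_one hy]
  nlinarith

/-- Adams' one-dimensional exponential inequality, in terms of the two Hölder estimates it uses. -/
theorem adams_exponential_bound {p q : ℝ} (hpq : q.HolderConjugate p) (hq2 : q ≤ 2) {K γ : ℝ}
    (hK : 0 ≤ K) (hγ : 0 < γ) :
    ∃ C : ℝ, 0 ≤ C ∧ ∀ S e : ℝ → ℝ, (∀ y, 0 ≤ S y) → (∀ y, 0 ≤ e y) → (∀ y, e y ≤ 1) →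
      (∀ y, 0 < y → S y ≤ y ^ (1 / q) * (1 - e y) ^ (1 / p) + K * e y ^ (1 / p)) →
      (∀ y₁ y₂, 0 < y₁ → y₁ ≤ y₂ →
        S y₂ ≤ y₁ ^ (1 / q) + e y₁ ^ (1 / p) * ((y₂ - y₁) ^ (1 / q) + K)) →
      ∫⁻ y in Set.Ioi (0 : ℝ), ENNReal.ofReal (exp (γ * (S y ^ q - y))) ≤ ENNReal.ofReal C := by
  have hq := hpq.pos
  have hq1 : 0 < q - 1 := by linarith [hpq.lt]
  have hp := hpq.symm.pos
  set c := 2 * (1 + K ^ q * 2 ^ (q - 1)) / (q - 1) with hc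
  have hc0 : 0 ≤ c := by positivity
  set b := 4 ^ (p - 1) * ((1 + K) ^ p * c) with hb
  have hb0 : 0 ≤ b := by positivity
  set L := 2 + 3 * b with hL
  have hL0 : 0 ≤ L := by positivity
  have hsum : Summable fun k : ℕ => exp (γ * (K ^ q + 1)) * (exp (-γ * k) * (L * k)) := by
    apply Summable.mul_left
    have := (Real.summable_pow_mul_exp_neg_nat_mul 1 hγ).mul_left L
    refine this.congr fun k => ?_
    rw [pow_one]; ring
  refine ⟨∑' k : ℕ, exp (γ * (K ^ q + 1)) * (exp (-γ * k) * (L * k)),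
    tsum_nonneg fun k => by positivity, fun S e hS he0 he1 h1 h2 => ?_⟩
  let E : ℕ → Set ℝ := fun k => {y | 0 < y ∧ y - k ≤ S y ^ q}
  have hE : ∀ k : ℕ, 1 ≤ k → volume (E k) ≤ ENNReal.ofReal (L * k) := by
    intro k hk
    have hk1 : (1 : ℝ) ≤ k := by exact_mod_cast hk
    have hsub : E k ⊆ Set.Icc 0 (b * k) ∪ (E k ∩ Set.Ioi (b * k)) := by
      intro y hy
      rcases le_or_gt y (b * k) with h | h
      · exact Or.inl ⟨hy.1.le, h⟩
      · exact Or.inr ⟨hy, h⟩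
    have hdiam : volume (E k ∩ Set.Ioi (b * k)) ≤ ENNReal.ofReal (2 * (1 + b) * k) := by
      refine (Real.volume_le_diam _).trans (Metric.ediam_le fun x hx y hy => ?_)
      have key : ∀ x ∈ E k ∩ Set.Ioi (b * k), ∀ y ∈ E k ∩ Set.Ioi (b * k), x ≤ y →
          y - x ≤ 2 * (1 + b) * k := by
        intro x hx y hy hxy
        have htail := tail_mass_le hpq hq2 hK (hS x) (he0 x) (he1 x) hx.1.1.le hk1 (h1 x hx.1.1)
          hx.1.2
        exact near_extremal_dist_le hpq hq2 hK (hS y) (he0 x) hc0 hk1 htail hb hx.1.1 hx.2.le hxy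
          (h2 x y hx.1.1 hxy) hy.1.2
      rw [edist_dist, Real.dist_eq]
      apply ENNReal.ofReal_le_ofReal
      rcases le_total x y with h | h
      · rw [abs_sub_comm, abs_of_nonneg (by linarith)]; exact key x hx y hy h
      · rw [abs_of_nonneg (by linarith)]; exact key y hy x hx h
    calc volume (E k) ≤ volume (Set.Icc 0 (b * k)) + volume (E k ∩ Set.Ioi (b * k)) :=
          (measure_mono hsub).trans (measure_union_le _ _)
      _ ≤ ENNReal.ofReal (b * k) + ENNReal.ofReal (2 * (1 + b) * k) := by
          gcongr; rw [Real.volume_Icc, sub_zero]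
      _ = ENNReal.ofReal (L * k) := by
          rw [← ENNReal.ofReal_add (by positivity) (by positivity)]; congr 1; rw [hL]; ring
  have hpt : ∀ y, 0 < y → ENNReal.ofReal (exp (γ * (S y ^ q - y))) ≤
      ∑' k : ℕ, (toMeasurable volume (E (k + 1))).indicator
        (fun _ => ENNReal.ofReal (exp (γ * (K ^ q + 1)) * exp (-γ * (k + 1 : ℕ)))) y := by
    intro y hy
    set F := y - S y ^ q with hF
    have hFK : -K ^ q ≤ F := by
      have : S y ≤ (y + K ^ q) ^ (1 / q) * (1 : ℝ) ^ (1 / p) := by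
        have h3 := two_term_holder hpq (a := 1 - e y) (b := e y) (u := y) (v := K ^ q)
          (by linarith [he1 y]) (he0 y) hy.le (by positivity)
        rw [← Real.rpow_mul hK, mul_one_div_cancel hq.ne', Real.rpow_one, sub_add_cancel] at h3
        exact (h1 y hy).trans h3
      have := rpow_le_of_le_holder_prod hpq (hS y) (by positivity) zero_le_one this
      rw [Real.one_rpow, mul_one] at this
      linarith
    have hKq : 0 ≤ K ^ q := by positivity
    set k := ⌈max F 1⌉₊ - 1 with hk
    have hk1 : k + 1 = ⌈max F 1⌉₊ := by
      have : 0 < ⌈max F 1⌉₊ := Nat.ceil_pos.2 (by positivity)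
      omega
    have hle : max F 1 ≤ (k + 1 : ℕ) := by rw [hk1]; exact Nat.le_ceil _
    have hlt : ((k + 1 : ℕ) : ℝ) < max F 1 + 1 := by
      rw [hk1]; exact Nat.ceil_lt_add_one (by positivity)
    have hmem : y ∈ toMeasurable volume (E (k + 1)) := by
      apply subset_toMeasurable
      exact ⟨hy, by linarith [le_max_left F 1]⟩
    refine le_trans ?_ (ENNReal.le_tsum k)
    rw [Set.indicator_of_mem hmem, ← Real.exp_add]
    apply ENNReal.ofReal_le_ofReal
    apply Real.exp_le_exp.2
    have : S y ^ q - y ≤ K ^ q + 1 - (k + 1 : ℕ) := by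
      rcases le_total F 1 with h | h
      · rw [max_eq_right h] at hle hlt
        have : k = 0 := by
          have : ((k + 1 : ℕ) : ℝ) < ((2 : ℕ) : ℝ) := by push_cast at hlt ⊢; linarith
          have := Nat.cast_lt.1 this
          omega
        rw [this]; push_cast; linarith
      · rw [max_eq_left h] at hlt
        linarith
    nlinarith
  calc ∫⁻ y in Set.Ioi (0 : ℝ), ENNReal.ofReal (exp (γ * (S y ^ q - y)))
      ≤ ∫⁻ y in Set.Ioi (0 : ℝ), ∑' k : ℕ, (toMeasurable volume (E (k + 1))).indicator
        (fun _ => ENNReal.ofReal (exp (γ * (K ^ q + 1)) * exp (-γ * (k + 1 : ℕ)))) y :=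
        setLIntegral_mono' measurableSet_Ioi fun y hy => hpt y hy
    _ ≤ ∫⁻ y, ∑' k : ℕ, (toMeasurable volume (E (k + 1))).indicator
        (fun _ => ENNReal.ofReal (exp (γ * (K ^ q + 1)) * exp (-γ * (k + 1 : ℕ)))) y :=
        setLIntegral_le_lintegral _ _
    _ = ∑' k : ℕ, ENNReal.ofReal (exp (γ * (K ^ q + 1)) * exp (-γ * (k + 1 : ℕ))) *
          volume (E (k + 1)) := by
        rw [lintegral_tsum fun k => (measurable_const.indicator
          (measurableSet_toMeasurable _ _)).aemeasurable]
        congr 1; ext k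
        rw [lintegral_indicator_const (measurableSet_toMeasurable _ _), measure_toMeasurable]
    _ ≤ ∑' k : ℕ, ENNReal.ofReal (exp (γ * (K ^ q + 1)) *
          (exp (-γ * (k + 1 : ℕ)) * (L * (k + 1 : ℕ)))) := by
        refine ENNReal.tsum_le_tsum fun k => ?_
        rw [← mul_assoc, ENNReal.ofReal_mul (q := L * (k + 1 : ℕ)) (by positivity)]
        gcongr
        exact hE _ (by omega)
    _ = ENNReal.ofReal (∑' k : ℕ, exp (γ * (K ^ q + 1)) *
          (exp (-γ * (k + 1 : ℕ)) * (L * (k + 1 : ℕ)))) :=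
        (ENNReal.ofReal_tsum_of_nonneg (fun k => by positivity)
          ((summable_nat_add_iff 1).2 hsum)).symm
    _ ≤ _ := by
        apply ENNReal.ofReal_le_ofReal
        rw [hsum.tsum_eq_zero_add]
        simp

/-- A function with distribution function at most `a * t ^ (-p)` has integral at most
`p / (p - 1) * a ^ (1 / p) * μ D ^ (1 - 1 / p)` over any set `D`. -/
theorem setLIntegral_le_of_distribution_le {X : Type*} [MeasurableSpace X] (μ : Measure X)
    {k : X → ℝ} (hk : Measurable k) (hk0 : ∀ x, 0 ≤ k x) {a p : ℝ} (ha : 0 < a) (hp : 1 < p)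
    (h : ∀ t, 0 < t → μ {x | t < k x} ≤ ENNReal.ofReal (a * t ^ (-p))) (D : Set X) :
    ∫⁻ x in D, ENNReal.ofReal (k x) ∂μ ≤
      ENNReal.ofReal (p / (p - 1) * a ^ (1 / p)) * μ D ^ (1 - 1 / p) := by
  have hp0 : 0 < p := by linarith
  have hp1 : 0 < p - 1 := by linarith
  have hpp : 0 < 1 - 1 / p := by
    rw [sub_pos, div_lt_one hp0]; exact hp
  rcases eq_or_ne (μ D) 0 with h0 | h0
  · rw [Measure.restrict_zero_set h0, lintegral_zero_measure]; exact zero_le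
  rcases eq_or_ne (μ D) ∞ with hi | hi
  · rw [hi, ENNReal.top_rpow_of_pos hpp, ENNReal.mul_top]
    · exact le_top
    · rw [Ne, ENNReal.ofReal_eq_zero, not_le]; positivity
  obtain ⟨d, hd, hD⟩ : ∃ d : ℝ, 0 < d ∧ μ D = ENNReal.ofReal d :=
    ⟨(μ D).toReal, ENNReal.toReal_pos h0 hi, (ENNReal.ofReal_toReal hi).symm⟩
  set l := (a / d) ^ (1 / p) with hl
  have hl0 : 0 < l := by positivity
  rw [lintegral_eq_lintegral_meas_lt _ (Filter.Eventually.of_forall hk0) hk.aemeasurable,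
    ← Set.Ioc_union_Ioi_eq_Ioi hl0.le]
  refine (lintegral_union_le _ _ _).trans ?_
  have h1 : ∫⁻ t in Set.Ioc 0 l, (μ.restrict D) {x | t < k x} ≤ ENNReal.ofReal (d * l) := by
    calc _ ≤ ∫⁻ t in Set.Ioc 0 l, μ D := by
          refine lintegral_mono fun t => ?_
          calc (μ.restrict D) {x | t < k x} ≤ (μ.restrict D) Set.univ := measure_mono (Set.subset_univ _)
            _ = μ D := by simp
      _ = _ := by
          rw [setLIntegral_const, hD, Real.volume_Ioc, ENNReal.ofReal_mul hd.le, sub_zero]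
  have h2 : ∫⁻ t in Set.Ioi l, (μ.restrict D) {x | t < k x} ≤
      ENNReal.ofReal (a * (l ^ (1 - p) / (p - 1))) := by
    calc _ ≤ ∫⁻ t in Set.Ioi l, ENNReal.ofReal (a * t ^ (-p)) := by
          refine setLIntegral_mono' measurableSet_Ioi fun t ht => ?_
          exact (Measure.restrict_apply_le _ _).trans (h t (hl0.trans ht))
      _ = ENNReal.ofReal (∫ t in Set.Ioi l, a * t ^ (-p)) := by
          rw [ofReal_integral_eq_lintegral_ofReal]
          · exact (integrableOn_Ioi_rpow_of_lt (by linarith) hl0).const_mul a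
          · refine (ae_restrict_mem measurableSet_Ioi).mono fun t ht => ?_
            have : 0 < t := hl0.trans ht
            simp only [Pi.zero_apply]; positivity
      _ = _ := by
          rw [integral_const_mul, integral_Ioi_rpow_of_lt (by linarith) hl0]
          congr 2
          rw [show -p + 1 = -(p - 1) by ring, neg_div_neg_eq]
          ring_nf
  refine (add_le_add h1 h2).trans ?_
  rw [hD, ENNReal.ofReal_rpow_of_pos hd, ← ENNReal.ofReal_mul (by positivity),
    ← ENNReal.ofReal_add (by positivity) (by positivity)]
  apply le_of_eq
  congr 1
  have e1 : d * l = a ^ (1 / p) * d ^ (1 - 1 / p) := by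
    rw [hl, Real.div_rpow ha.le hd.le, Real.rpow_sub hd, Real.rpow_one]; ring
  have e2 : a * l ^ (1 - p) = a ^ (1 / p) * d ^ (1 - 1 / p) := by
    have : l ^ p = a / d := by
      rw [hl, ← Real.rpow_mul (by positivity), one_div_mul_cancel hp0.ne', Real.rpow_one]
    rw [Real.rpow_sub hl0, Real.rpow_one, this, ← e1]
    field_simp
  rw [← mul_div_assoc, e1, e2]
  field_simp
  ring

/-- The kernel average appearing in O'Neil's inequality, as a function of the distribution
function `N` of the density and of the size `s` of the set over which one averages. -/
def oneilSum (p : ℝ) (N : ℝ → ℝ≥0∞) (s : ℝ) : ℝ≥0∞ :=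
  ∫⁻ a in Set.Ioi (0 : ℝ), min (N a ^ (1 / p)) (N a * ENNReal.ofReal (s ^ (1 / p - 1)))

/-- The decreasing rearrangement attached to a distribution function `N`. -/
def rearr (N : ℝ → ℝ≥0∞) (s : ℝ) : ℝ≥0∞ :=
  volume {a : ℝ | 0 < a ∧ ENNReal.ofReal s < N a}

theorem measurableSet_rearr {N : ℝ → ℝ≥0∞} (hN : Antitone N) :
    MeasurableSet {z : ℝ × ℝ | 0 < z.2 ∧ ENNReal.ofReal z.1 < N z.2} :=
  (measurableSet_lt measurable_const measurable_snd).inter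
    (measurableSet_lt (ENNReal.measurable_ofReal.comp measurable_fst)
      (hN.measurable.comp measurable_snd))

theorem measurable_rearr {N : ℝ → ℝ≥0∞} (hN : Antitone N) : Measurable (rearr N) :=
  measurable_measure_prodMk_left (measurableSet_rearr hN)

/-- Fubini for weighted integrals of the rearrangement. -/
theorem lintegral_mul_rearr {N : ℝ → ℝ≥0∞} (hN : Antitone N) {u : ℝ → ℝ≥0∞}
    (hu : Measurable u) (I : Set ℝ) :
    ∫⁻ s in I, u s * rearr N s =
      ∫⁻ a in Set.Ioi (0 : ℝ), ∫⁻ s in I, {s | ENNReal.ofReal s < N a}.indicator u s := by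
  have hm := measurableSet_rearr hN
  rw [← lintegral_indicator measurableSet_Ioi]
  have : ∀ a : ℝ, (Set.Ioi (0 : ℝ)).indicator
      (fun a => ∫⁻ s in I, {s | ENNReal.ofReal s < N a}.indicator u s) a =
      ∫⁻ s in I, {z : ℝ × ℝ | 0 < z.2 ∧ ENNReal.ofReal z.1 < N z.2}.indicator
        (fun z => u z.1) (s, a) := by
    intro a
    by_cases ha : 0 < a
    · rw [Set.indicator_of_mem (Set.mem_Ioi.2 ha)]
      refine lintegral_congr fun s => ?_
      simp [Set.indicator_apply, ha]
    · rw [Set.indicator_of_notMem (by simpa using ha)]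
      simp [ha]
  simp_rw [this]
  rw [lintegral_lintegral_swap]
  · refine lintegral_congr fun s => ?_
    rw [rearr, ← lintegral_indicator_one, ← lintegral_const_mul]
    · refine lintegral_congr fun a => ?_
      simp [Set.indicator_apply]
    · exact measurable_one.indicator (measurable_prodMk_left hm)
    · exact measurable_prodMk_left hm
  · exact (((hu.comp measurable_fst).indicator hm).comp measurable_swap).aemeasurable

theorem volume_ofReal_lt (c : ℝ≥0∞) : volume {s : ℝ | 0 < s ∧ ENNReal.ofReal s < c} = c := by
  rcases eq_or_ne c ∞ with rfl | hc
  · have : {s : ℝ | 0 < s ∧ ENNReal.ofReal s < ∞} = Set.Ioi 0 := by ext; simp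
    rw [this, Real.volume_Ioi]
  · have : {s : ℝ | 0 < s ∧ ENNReal.ofReal s < c} = Set.Ioo 0 c.toReal := by
      ext s
      simp only [Set.mem_ofPred_eq, Set.mem_Ioo]
      refine and_congr_right fun hs => ?_
      rw [ENNReal.ofReal_lt_iff_lt_toReal hs.le hc]
    rw [this, Real.volume_Ioo, sub_zero, ENNReal.ofReal_toReal hc]

theorem lintegral_Ioo_rpow {p b : ℝ} (hp : 0 < p) (hb : 0 ≤ b) :
    ∫⁻ a in Set.Ioo 0 b, ENNReal.ofReal (p * a ^ (p - 1)) = ENNReal.ofReal (b ^ p) := by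
  rw [← ofReal_integral_eq_lintegral_ofReal]
  · rw [← integral_Ioc_eq_integral_Ioo, ← intervalIntegral.integral_of_le hb,
      intervalIntegral.integral_const_mul, integral_rpow (Or.inl (by linarith))]
    congr 1
    rw [sub_add_cancel, Real.zero_rpow hp.ne']
    field_simp
    ring
  · have := (intervalIntegral.intervalIntegrable_rpow' (a := 0) (b := b) (r := p - 1)
      (by linarith)).const_mul p
    rw [intervalIntegrable_iff_integrableOn_Ioo_of_le hb] at this
    exact this
  · refine (ae_restrict_mem measurableSet_Ioo).mono fun t ht => ?_
    have := ht.1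
    simp only [Pi.zero_apply]; positivity

theorem rearr_rpow_le {N : ℝ → ℝ≥0∞} (hN : Antitone N) {p : ℝ} (hp : 0 < p) (s : ℝ) :
    rearr N s ^ p ≤ ∫⁻ a in Set.Ioi (0 : ℝ), {a | ENNReal.ofReal s < N a}.indicator
      (fun a => ENNReal.ofReal (p * a ^ (p - 1))) a := by
  have hm : MeasurableSet {a : ℝ | ENNReal.ofReal s < N a} :=
    measurableSet_lt measurable_const hN.measurable
  refine ENNReal.le_of_forall_nnreal_lt fun r hr => ?_
  set b : ℝ := (r : ℝ) ^ (1 / p) with hb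
  have hb0 : 0 ≤ b := by positivity
  have hbp : b ^ p = r := by
    rw [hb, ← Real.rpow_mul r.coe_nonneg, one_div_mul_cancel hp.ne', Real.rpow_one]
  have hbr : ENNReal.ofReal b < rearr N s := by
    by_contra hcon
    rw [not_lt] at hcon
    have := ENNReal.rpow_le_rpow hcon hp.le
    rw [ENNReal.ofReal_rpow_of_nonneg hb0 hp.le, hbp, ENNReal.ofReal_coe_nnreal] at this
    exact absurd hr (not_lt.2 this)
  obtain ⟨a, ha, hab⟩ : ∃ a, (0 < a ∧ ENNReal.ofReal s < N a) ∧ b ≤ a := by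
    by_contra hcon
    push Not at hcon
    have : rearr N s ≤ volume (Set.Ioo 0 b) := measure_mono fun a ha => ⟨ha.1, hcon a ha⟩
    rw [Real.volume_Ioo, sub_zero] at this
    exact absurd hbr (not_lt.2 this)
  calc (r : ℝ≥0∞) = ENNReal.ofReal (b ^ p) := by rw [hbp, ENNReal.ofReal_coe_nnreal]
    _ = ∫⁻ a in Set.Ioo 0 b, ENNReal.ofReal (p * a ^ (p - 1)) := (lintegral_Ioo_rpow hp hb0).symm
    _ = ∫⁻ x in Set.Ioo 0 b, {a | ENNReal.ofReal s < N a}.indicator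
          (fun a => ENNReal.ofReal (p * a ^ (p - 1))) x := by
        refine setLIntegral_congr_fun measurableSet_Ioo fun x hx => ?_
        rw [Set.indicator_of_mem]
        exact ha.2.trans_le (hN (hx.2.le.trans hab))
    _ ≤ _ := lintegral_mono_set fun x hx => hx.1

/-- The rearrangement has `L^p` norm at most that of a function with distribution `N`. -/
theorem lintegral_rearr_rpow_le {N : ℝ → ℝ≥0∞} (hN : Antitone N) {p : ℝ} (hp : 0 < p) :
    ∫⁻ s in Set.Ioi (0 : ℝ), rearr N s ^ p ≤
      ∫⁻ a in Set.Ioi (0 : ℝ), N a * ENNReal.ofReal (p * a ^ (p - 1)) := by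
  have hm : MeasurableSet {z : ℝ × ℝ | ENNReal.ofReal z.1 < N z.2} :=
    measurableSet_lt (ENNReal.measurable_ofReal.comp measurable_fst)
      (hN.measurable.comp measurable_snd)
  refine (lintegral_mono fun s => rearr_rpow_le hN hp s).trans ?_
  rw [lintegral_lintegral_swap]
  · refine lintegral_mono fun a => ?_
    have : (fun s : ℝ => {a | ENNReal.ofReal s < N a}.indicator
        (fun a => ENNReal.ofReal (p * a ^ (p - 1))) a) =
        {s | ENNReal.ofReal s < N a}.indicator (fun _ => ENNReal.ofReal (p * a ^ (p - 1))) := by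
      ext s; simp [Set.indicator_apply]
    have hma : MeasurableSet {s | ENNReal.ofReal s < N a} := measurable_prodMk_right hm
    rw [this, lintegral_indicator_const hma, mul_comm]
    gcongr
    rw [Measure.restrict_apply hma]
    refine le_of_eq ?_
    refine Eq.trans ?_ (volume_ofReal_lt (N a))
    congr 1
    ext s; simp [and_comm]
  · have h : Measurable fun z : ℝ × ℝ => {z : ℝ × ℝ | ENNReal.ofReal z.1 < N z.2}.indicator
        (fun z => ENNReal.ofReal (p * z.2 ^ (p - 1))) z :=
      Measurable.indicator (by fun_prop) hm
    exact h.aemeasurable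

/-- The kernel average is at most its expression through the decreasing rearrangement. -/
theorem oneilSum_le {N : ℝ → ℝ≥0∞} (hN : Antitone N) {p M m : ℝ} (hp : 1 < p)
    (hM : ∀ a, 0 < a → N a ≤ ENNReal.ofReal M) (hm : 0 < m) (hmM : m ≤ M) :
    ENNReal.ofReal p * oneilSum p N m ≤
      (∫⁻ s in Set.Ioo 0 m, ENNReal.ofReal (p * m ^ (1 / p - 1)) * rearr N s) +
        ∫⁻ s in Set.Ico m M, ENNReal.ofReal (s ^ (1 / p - 1)) * rearr N s := by
  have hp0 : 0 < p := by linarith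
  rw [lintegral_mul_rearr hN measurable_const, lintegral_mul_rearr hN (by fun_prop),
    ← lintegral_add_left', oneilSum, ← lintegral_const_mul']
  rotate_left
  · exact ENNReal.ofReal_ne_top
  · have hmm : MeasurableSet {z : ℝ × ℝ | ENNReal.ofReal z.2 < N z.1} :=
      measurableSet_lt (ENNReal.measurable_ofReal.comp measurable_snd)
        (hN.measurable.comp measurable_fst)
    have h : Measurable fun z : ℝ × ℝ => {z : ℝ × ℝ | ENNReal.ofReal z.2 < N z.1}.indicator
        (fun z => ENNReal.ofReal (p * m ^ (1 / p - 1))) z :=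
      Measurable.indicator (by fun_prop) hmm
    exact h.lintegral_prod_right'.aemeasurable
  refine setLIntegral_mono' measurableSet_Ioi fun a ha => ?_
  have hNa := hM a ha
  have hfin : N a ≠ ∞ := ne_top_of_le_ne_top ENNReal.ofReal_ne_top hNa
  obtain ⟨d, hd0, hd⟩ : ∃ d : ℝ, 0 ≤ d ∧ N a = ENNReal.ofReal d :=
    ⟨(N a).toReal, ENNReal.toReal_nonneg, (ENNReal.ofReal_toReal hfin).symm⟩
  have hdM : d ≤ M := by
    rw [hd] at hNa
    exact (ENNReal.ofReal_le_ofReal_iff (by linarith)).1 hNa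
  rw [hd]
  have hset : MeasurableSet {s : ℝ | ENNReal.ofReal s < ENNReal.ofReal d} :=
    measurableSet_lt (by fun_prop) measurable_const
  rw [setLIntegral_indicator hset, setLIntegral_indicator hset]
  rcases le_total d m with h | h
  · refine le_trans ?_ (le_add_of_nonneg_right zero_le)
    have hsub : Set.Ioo 0 d ⊆ {s : ℝ | ENNReal.ofReal s < ENNReal.ofReal d} ∩ Set.Ioo 0 m := by
      intro s hs
      exact ⟨(ENNReal.ofReal_lt_ofReal_iff (hs.1.trans hs.2)).2 hs.2, hs.1, hs.2.trans_le h⟩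
    refine le_trans ?_ (lintegral_mono_set hsub)
    rw [setLIntegral_const, Real.volume_Ioo, sub_zero]
    refine (mul_le_mul_right (min_le_right _ _) _).trans (le_of_eq ?_)
    rw [ENNReal.ofReal_mul hp0.le]; ring
  · have hsub1 : Set.Ioo 0 m ⊆ {s : ℝ | ENNReal.ofReal s < ENNReal.ofReal d} ∩ Set.Ioo 0 m := by
      intro s hs
      exact ⟨(ENNReal.ofReal_lt_ofReal_iff (hm.trans_le h)).2 (hs.2.trans_le h), hs⟩
    have hsub2 : Set.Ioo m d ⊆ {s : ℝ | ENNReal.ofReal s < ENNReal.ofReal d} ∩ Set.Ico m M := by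
      intro s hs
      exact ⟨(ENNReal.ofReal_lt_ofReal_iff (hm.trans_le h)).2 hs.2, hs.1.le, hs.2.trans_le hdM⟩
    refine le_trans ?_ (add_le_add (lintegral_mono_set hsub1) (lintegral_mono_set hsub2))
    have e2 : ∫⁻ s in Set.Ioo m d, ENNReal.ofReal (s ^ (1 / p - 1)) =
        ENNReal.ofReal (p * (d ^ (1 / p) - m ^ (1 / p))) := by
      rw [← ofReal_integral_eq_lintegral_ofReal]
      · rw [← integral_Ioc_eq_integral_Ioo, ← intervalIntegral.integral_of_le h,
          integral_rpow (Or.inl (by linarith [show 0 < 1 / p by positivity]))]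
        congr 1
        rw [sub_add_cancel]
        field_simp
      · have := (intervalIntegral.intervalIntegrable_rpow' (a := m) (b := d) (r := 1 / p - 1)
          (by linarith [show 0 < 1 / p by positivity]))
        rwa [intervalIntegrable_iff_integrableOn_Ioo_of_le h] at this
      · refine (ae_restrict_mem measurableSet_Ioo).mono fun t ht => ?_
        have := hm.trans ht.1
        simp only [Pi.zero_apply]; positivity
    have hmd : m ^ (1 / p) ≤ d ^ (1 / p) := Real.rpow_le_rpow hm.le h (by positivity)
    rw [e2, setLIntegral_const, Real.volume_Ioo, sub_zero,
      ← ENNReal.ofReal_mul (p := p * m ^ (1 / p - 1)) (by positivity),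
      ← ENNReal.ofReal_add (by positivity)
        (mul_nonneg hp0.le (sub_nonneg.2 hmd))]
    refine (mul_le_mul_right (min_le_left _ _) _).trans (le_of_eq ?_)
    rw [ENNReal.ofReal_rpow_of_nonneg hd0 (by positivity), ← ENNReal.ofReal_mul hp0.le]
    congr 1
    rw [Real.rpow_sub hm, Real.rpow_one]
    field_simp
    ring

/-- O'Neil's inequality: the integral over `E` of a kernel operator applied to `f`, in terms of the
distribution function of `f`. -/
theorem setLIntegral_kernel_le {X : Type*} [MeasurableSpace X] (μ : Measure X) [SFinite μ]
    {k : X → X → ℝ≥0∞} (hk : Measurable (Function.uncurry k)) {B : ℝ≥0∞} {p : ℝ} (hp : 1 < p)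
    (h1 : ∀ ξ D, MeasurableSet D → ∫⁻ η in D, k ξ η ∂μ ≤ B * μ D ^ (1 / p))
    (h2 : ∀ η E, MeasurableSet E → ∫⁻ ξ in E, k ξ η ∂μ ≤ B * μ E ^ (1 / p))
    {f : X → ℝ} (hf : Measurable f) {E : Set X} (hE : MeasurableSet E) {s : ℝ} (hs : 0 < s)
    (hsE : ENNReal.ofReal s ≤ μ E) (hEfin : μ E ≠ ∞) :
    ∫⁻ ξ in E, ∫⁻ η, ENNReal.ofReal (f η) * k ξ η ∂μ ∂μ ≤
      B * μ E * oneilSum p (fun a => μ {x | a < f x}) s := by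
  have hp0 : 0 < p := by linarith
  have hD : ∀ a, MeasurableSet {x | a < f x} := fun a => measurableSet_lt measurable_const hf
  have hN : Antitone fun a => μ {x | a < f x} :=
    fun a b hab => measure_mono fun x hx => hab.trans_lt hx
  have hset : MeasurableSet {z : X × ℝ | z.2 < f z.1} :=
    measurableSet_lt measurable_snd (hf.comp measurable_fst)
  have hlayer : ∀ ξ, ∫⁻ η, ENNReal.ofReal (f η) * k ξ η ∂μ =
      ∫⁻ a in Set.Ioi (0 : ℝ), ∫⁻ η in {x | a < f x}, k ξ η ∂μ := by
    intro ξ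
    have e1 : ∀ a : ℝ, ∫⁻ η in {x | a < f x}, k ξ η ∂μ =
        ∫⁻ η, {z : X × ℝ | z.2 < f z.1}.indicator (fun z => k ξ z.1) (η, a) ∂μ := by
      intro a
      rw [← lintegral_indicator (hD a)]
      rfl
    simp_rw [e1]
    rw [lintegral_lintegral_swap]
    · refine lintegral_congr fun η => ?_
      have e2 : (fun a : ℝ => {z : X × ℝ | z.2 < f z.1}.indicator (fun z => k ξ z.1) (η, a)) =
          (Set.Iio (f η)).indicator fun _ => k ξ η := by
        ext a; simp [Set.indicator_apply]
      rw [e2, lintegral_indicator_const measurableSet_Iio, mul_comm,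
        Measure.restrict_apply measurableSet_Iio, Set.inter_comm, Set.Ioi_inter_Iio,
        Real.volume_Ioo, sub_zero]
    · have : Measurable fun z : X × ℝ => k ξ z.1 :=
        hk.comp (by fun_prop : Measurable fun z : X × ℝ => (ξ, z.1))
      exact ((this.indicator hset).comp measurable_swap).aemeasurable
  simp_rw [hlayer]
  rw [lintegral_lintegral_swap]
  rotate_left
  · have e1 : (Function.uncurry fun ξ (a : ℝ) => ∫⁻ η in {x | a < f x}, k ξ η ∂μ) =
        fun z : X × ℝ => ∫⁻ η, {w : (X × ℝ) × X | w.1.2 < f w.2}.indicator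
          (fun w => k w.1.1 w.2) (z, η) ∂μ := by
      ext z
      rw [Function.uncurry, ← lintegral_indicator (hD z.2)]
      rfl
    rw [e1]
    have hs3 : MeasurableSet {w : (X × ℝ) × X | w.1.2 < f w.2} :=
      measurableSet_lt (by fun_prop) (hf.comp measurable_snd)
    have : Measurable fun w : (X × ℝ) × X => k w.1.1 w.2 :=
      hk.comp (by fun_prop : Measurable fun w : (X × ℝ) × X => (w.1.1, w.2))
    exact (this.indicator hs3).lintegral_prod_right'.aemeasurable
  rw [oneilSum, ← lintegral_const_mul]
  rotate_left
  · exact (hN.measurable.pow_const _).min (hN.measurable.mul_const _)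
  refine lintegral_mono fun a => ?_
  rw [mul_min]
  refine le_min ?_ ?_
  · calc ∫⁻ ξ in E, ∫⁻ η in {x | a < f x}, k ξ η ∂μ ∂μ
        ≤ ∫⁻ ξ in E, B * μ {x | a < f x} ^ (1 / p) ∂μ := lintegral_mono fun ξ => h1 ξ _ (hD a)
      _ = _ := by rw [setLIntegral_const]; ring
  · have hkk : AEMeasurable (Function.uncurry k)
        ((μ.restrict E).prod (μ.restrict {x | a < f x})) := hk.aemeasurable
    have hEs : μ E ^ (1 / p) ≤ μ E * ENNReal.ofReal (s ^ (1 / p - 1)) := by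
      obtain ⟨m, hm0, hm⟩ : ∃ m : ℝ, 0 ≤ m ∧ μ E = ENNReal.ofReal m :=
        ⟨(μ E).toReal, ENNReal.toReal_nonneg, (ENNReal.ofReal_toReal hEfin).symm⟩
      rw [hm] at hsE ⊢
      have hsm : s ≤ m := (ENNReal.ofReal_le_ofReal_iff hm0).1 hsE
      have hm1 : 0 < m := hs.trans_le hsm
      rw [ENNReal.ofReal_rpow_of_pos hm1, ← ENNReal.ofReal_mul hm0]
      apply ENNReal.ofReal_le_ofReal
      calc m ^ (1 / p) = m * m ^ (1 / p - 1) := by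
            rw [Real.rpow_sub hm1, Real.rpow_one]; field_simp
        _ ≤ m * s ^ (1 / p - 1) := by
            gcongr m * ?_
            apply Real.rpow_le_rpow_of_nonpos hs hsm
            rw [sub_nonpos, div_le_one hp0]; exact hp.le
    rw [lintegral_lintegral_swap hkk]
    calc ∫⁻ η in {x | a < f x}, ∫⁻ ξ in E, k ξ η ∂μ ∂μ
        ≤ ∫⁻ η in {x | a < f x}, B * μ E ^ (1 / p) ∂μ := lintegral_mono fun η => h2 η _ hE
      _ = B * μ E ^ (1 / p) * μ {x | a < f x} := by rw [setLIntegral_const]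
      _ ≤ B * (μ E * ENNReal.ofReal (s ^ (1 / p - 1))) * μ {x | a < f x} := by gcongr
      _ = _ := by ring

theorem setLIntegral_le_holder {p q : ℝ} (hpq : q.HolderConjugate p) {g : ℝ → ℝ≥0∞}
    (hg : Measurable g) (I : Set ℝ) :
    ∫⁻ s in I, g s ≤ (∫⁻ s in I, g s ^ p) ^ (1 / p) * volume I ^ (1 / q) := by
  have := ENNReal.lintegral_mul_le_Lp_mul_Lq (volume.restrict I) hpq.symm hg.aemeasurable
    (g := fun _ => 1) measurable_const.aemeasurable
  simpa using this

theorem setLIntegral_rpow_mul_le_holder {p q : ℝ} (hpq : q.HolderConjugate p) {g : ℝ → ℝ≥0∞}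
    (hg : Measurable g) {a b : ℝ} (ha : 0 < a) (hab : a ≤ b) :
    ∫⁻ s in Set.Ico a b, ENNReal.ofReal (s ^ (1 / p - 1)) * g s ≤
      (∫⁻ s in Set.Ico a b, g s ^ p) ^ (1 / p) * ENNReal.ofReal (log (b / a) ^ (1 / q)) := by
  have hq := hpq.pos
  have hp := hpq.symm.pos
  have hb : 0 < b := ha.trans_le hab
  have hexp : (1 / p - 1) * q = -1 := by
    have := hpq.inv_add_inv_eq_one
    field_simp at this ⊢
    linarith
  have h := ENNReal.lintegral_mul_le_Lp_mul_Lq (volume.restrict (Set.Ico a b)) hpq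
    (f := fun s => ENNReal.ofReal (s ^ (1 / p - 1))) (g := g)
    (by fun_prop) hg.aemeasurable
  have hlog : ∫⁻ s in Set.Ico a b, ENNReal.ofReal (s ^ (1 / p - 1)) ^ q =
      ENNReal.ofReal (log (b / a)) := by
    calc _ = ∫⁻ s in Set.Ico a b, ENNReal.ofReal s⁻¹ := by
          refine setLIntegral_congr_fun measurableSet_Ico fun s hs => ?_
          have hs0 : 0 < s := ha.trans_le hs.1
          rw [ENNReal.ofReal_rpow_of_pos (by positivity), ← Real.rpow_mul hs0.le, hexp,
            Real.rpow_neg_one]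
      _ = ENNReal.ofReal (∫ s in Set.Ico a b, s⁻¹) := by
          rw [ofReal_integral_eq_lintegral_ofReal]
          · apply (ContinuousOn.integrableOn_compact isCompact_Icc ?_).mono_set Set.Ico_subset_Icc_self
            exact continuousOn_inv₀.mono fun s hs => (ha.trans_le hs.1).ne'
          · refine (ae_restrict_mem measurableSet_Ico).mono fun s hs => ?_
            have : 0 < s := ha.trans_le hs.1
            simp only [Pi.zero_apply]; positivity
      _ = _ := by
          rw [integral_Ico_eq_integral_Ioo, ← integral_Ioc_eq_integral_Ioo,
            ← intervalIntegral.integral_of_le hab, integral_inv_of_pos ha hb]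
  rw [hlog] at h
  rw [mul_comm]
  rw [ENNReal.ofReal_rpow_of_nonneg (Real.log_nonneg (by rwa [le_div_iff₀ ha, one_mul]))
    (by positivity)] at h
  exact h

/-- Change of variables `s = M * exp (-y)`. -/
theorem lintegral_Ioo_eq_lintegral_exp_neg {M : ℝ} (hM : 0 < M) (F : ℝ → ℝ≥0∞) :
    ∫⁻ s in Set.Ioo 0 M, F s =
      ∫⁻ y in Set.Ioi (0 : ℝ), ENNReal.ofReal (M * exp (-y)) * F (M * exp (-y)) := by
  have himg : (fun y : ℝ => M * exp (-y)) '' Set.Ioi 0 = Set.Ioo 0 M := by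
    ext s
    simp only [Set.mem_image, Set.mem_Ioi, Set.mem_Ioo]
    constructor
    · rintro ⟨y, hy, rfl⟩
      refine ⟨by positivity, ?_⟩
      have : exp (-y) < 1 := Real.exp_lt_one_iff.2 (by linarith)
      nlinarith
    · rintro ⟨h0, h1⟩
      refine ⟨log (M / s), Real.log_pos (by rwa [lt_div_iff₀ h0, one_mul]), ?_⟩
      rw [← Real.log_inv, Real.exp_log (by positivity)]
      field_simp
  have hder : ∀ y ∈ Set.Ioi (0 : ℝ),
      HasDerivWithinAt (fun y : ℝ => M * exp (-y)) (-(M * exp (-y))) (Set.Ioi 0) y := by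
    intro y _
    have := ((hasDerivAt_neg y).exp.const_mul M).hasDerivWithinAt (s := Set.Ioi 0)
    simpa using this
  have hinj : Set.InjOn (fun y : ℝ => M * exp (-y)) (Set.Ioi 0) := by
    intro x _ y _ hxy
    have := mul_left_cancel₀ hM.ne' hxy
    simpa using this
  rw [← himg, lintegral_image_eq_lintegral_abs_deriv_mul measurableSet_Ioi hder hinj]
  refine lintegral_congr fun y => ?_
  rw [abs_neg, abs_of_pos (by positivity)]

theorem setLIntegral_Ico_log_le {p q : ℝ} (hpq : q.HolderConjugate p) {g : ℝ → ℝ≥0∞}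
    (hg : Measurable g) {a b c : ℝ} (ha : 0 < a) (hab : a ≤ b) (hc : 0 ≤ c)
    (h : ∫⁻ s in Set.Ico a b, g s ^ p ≤ ENNReal.ofReal c) :
    ∫⁻ s in Set.Ico a b, ENNReal.ofReal (s ^ (1 / p - 1)) * g s ≤
      ENNReal.ofReal (c ^ (1 / p) * log (b / a) ^ (1 / q)) := by
  have hp := hpq.symm.pos
  refine (setLIntegral_rpow_mul_le_holder hpq hg ha hab).trans ?_
  rw [ENNReal.ofReal_mul (by positivity), ← ENNReal.ofReal_rpow_of_nonneg hc (by positivity)]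
  gcongr

theorem setLIntegral_Ioo_mul_le {p q : ℝ} (hpq : q.HolderConjugate p) {g : ℝ → ℝ≥0∞}
    (hg : Measurable g) {m c : ℝ} (hm : 0 < m) (hc : 0 ≤ c)
    (h : ∫⁻ s in Set.Ioo 0 m, g s ^ p ≤ ENNReal.ofReal c) :
    ∫⁻ s in Set.Ioo 0 m, ENNReal.ofReal (p * m ^ (1 / p - 1)) * g s ≤
      ENNReal.ofReal (p * c ^ (1 / p)) := by
  have hp := hpq.symm.pos
  have hq := hpq.pos
  rw [lintegral_const_mul _ hg]
  refine (mul_le_mul_right (setLIntegral_le_holder hpq hg _) _).trans ?_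
  rw [Real.volume_Ioo, sub_zero, ENNReal.ofReal_rpow_of_pos hm]
  have h2 : (∫⁻ s in Set.Ioo 0 m, g s ^ p) ^ (1 / p) ≤ ENNReal.ofReal (c ^ (1 / p)) := by
    rw [← ENNReal.ofReal_rpow_of_nonneg hc (by positivity)]
    gcongr
  refine (mul_le_mul_right (mul_le_mul_left h2 _) _).trans (le_of_eq ?_)
  rw [← ENNReal.ofReal_mul (by positivity), ← ENNReal.ofReal_mul (by positivity)]
  congr 1
  have e : m ^ (1 / p - 1) * m ^ (1 / q) = 1 := by
    rw [← Real.rpow_add hm]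
    have := hpq.inv_add_inv_eq_one
    rw [show 1 / p - 1 + 1 / q = 0 by simp only [one_div]; linarith, Real.rpow_zero]
  linear_combination p * c ^ (1 / p) * e

/-- Exponential integrability of the rearranged potential of a normalized density. -/
theorem exists_exp_oneilSum_bound {p q : ℝ} (hpq : q.HolderConjugate p) (hq2 : q ≤ 2) {γ : ℝ}
    (hγ : 0 < γ) :
    ∃ C : ℝ, 0 ≤ C ∧ ∀ (N : ℝ → ℝ≥0∞) (M : ℝ), Antitone N → 0 < M →
      (∀ a, 0 < a → N a ≤ ENNReal.ofReal M) →
      (∫⁻ a in Set.Ioi (0 : ℝ), N a * ENNReal.ofReal (p * a ^ (p - 1)) ≤ 1) →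
      (∀ s ∈ Set.Ioo 0 M, oneilSum p N s ≠ ∞) ∧
      ∫⁻ s in Set.Ioo 0 M, ENNReal.ofReal
        (exp (γ * (p * (oneilSum p N s).toReal) ^ q) * s ^ (γ - 1)) ≤
          ENNReal.ofReal (M ^ γ * C) := by
  have hp := hpq.symm.pos
  have hp1 := hpq.symm.lt
  have hq := hpq.pos
  obtain ⟨C, hC0, hC⟩ := adams_exponential_bound hpq hq2 hp.le hγ
  refine ⟨C, hC0, fun N M hN hM hNM hint => ?_⟩
  set g := rearr N with hgdef
  have hg : Measurable g := measurable_rearr hN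
  have htot : ∫⁻ s in Set.Ioi (0 : ℝ), g s ^ p ≤ 1 := (lintegral_rearr_rpow_le hN hp).trans hint
  have hfin : ∀ I ⊆ Set.Ioi (0 : ℝ), ∫⁻ s in I, g s ^ p ≤ 1 :=
    fun I hI => (lintegral_mono_set hI).trans htot
  set m : ℝ → ℝ := fun y => M * exp (-y) with hmdef
  have hm0 : ∀ y, 0 < m y := fun y => by positivity
  have hmanti : Antitone m := fun x y hxy => by
    simp only [hmdef]; gcongr
  have hmM : ∀ y, 0 < y → m y ≤ M := fun y hy => by
    have : exp (-y) ≤ 1 := Real.exp_le_one_iff.2 (by linarith)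
    simp only [hmdef]; nlinarith
  have hlog : ∀ y z, log (m y / m z) = z - y := by
    intro y z
    simp only [hmdef]
    rw [mul_div_mul_left _ _ hM.ne', ← Real.exp_sub, Real.log_exp]; ring
  have hlogM : ∀ z, log (M / m z) = z := by
    intro z
    have := hlog 0 z
    simpa [hmdef] using this
  set e : ℝ → ℝ := fun y => (∫⁻ s in Set.Ioo 0 (m y), g s ^ p).toReal with hedef
  have hne : ∀ y, ∫⁻ s in Set.Ioo 0 (m y), g s ^ p ≤ 1 := fun y => hfin _ fun s hs => hs.1
  have he : ∀ y, ∫⁻ s in Set.Ioo 0 (m y), g s ^ p = ENNReal.ofReal (e y) := fun y =>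
    (ENNReal.ofReal_toReal (ne_top_of_le_ne_top ENNReal.one_ne_top (hne y))).symm
  have he0 : ∀ y, 0 ≤ e y := fun y => ENNReal.toReal_nonneg
  have he1 : ∀ y, e y ≤ 1 := fun y => ENNReal.toReal_le_of_le_ofReal zero_le_one (by
    simpa using hne y)
  have heanti : Antitone e := by
    intro x y hxy
    have : ENNReal.ofReal (e y) ≤ ENNReal.ofReal (e x) := by
      rw [← he, ← he]
      exact lintegral_mono_set (Set.Ioo_subset_Ioo_right (hmanti hxy))
    exact (ENNReal.ofReal_le_ofReal_iff (he0 x)).1 this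
  have hfirst : ∀ y, ∫⁻ s in Set.Ioo 0 (m y), ENNReal.ofReal (p * m y ^ (1 / p - 1)) * g s ≤
      ENNReal.ofReal (p * e y ^ (1 / p)) := fun y =>
    setLIntegral_Ioo_mul_le hpq hg (hm0 y) (he0 y) (he y).le
  have hcompl : ∀ y, 0 < y → ∫⁻ s in Set.Ico (m y) M, g s ^ p ≤ ENNReal.ofReal (1 - e y) := by
    intro y hy
    have hunion : Set.Ioo 0 (m y) ∪ Set.Ico (m y) M = Set.Ioo 0 M :=
      Set.Ioo_union_Ico_eq_Ioo (hm0 y) (hmM y hy)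
    have hsum : (∫⁻ s in Set.Ioo 0 (m y), g s ^ p) + ∫⁻ s in Set.Ico (m y) M, g s ^ p =
        ∫⁻ s in Set.Ioo 0 M, g s ^ p := by
      rw [← hunion, lintegral_union measurableSet_Ico]
      exact Set.disjoint_left.2 fun s h1 h2 => absurd h1.2 (not_lt.2 h2.1)
    have h1 := hfin (Set.Ioo 0 M) fun s hs => hs.1
    rw [← hsum, he] at h1
    rw [ENNReal.ofReal_sub _ (he0 y), ENNReal.ofReal_one]
    exact ENNReal.le_sub_of_add_le_left ENNReal.ofReal_ne_top h1
  have hO : ∀ y, 0 < y → ENNReal.ofReal p * oneilSum p N (m y) ≤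
      ENNReal.ofReal (y ^ (1 / q) * (1 - e y) ^ (1 / p) + p * e y ^ (1 / p)) := by
    intro y hy
    refine (oneilSum_le hN hp1 hNM (hm0 y) (hmM y hy)).trans ?_
    have h1e := sub_nonneg.2 (he1 y)
    have h2 := setLIntegral_Ico_log_le hpq hg (hm0 y) (hmM y hy) h1e (hcompl y hy)
    rw [hlogM] at h2
    have he0' := he0 y
    rw [add_comm, ENNReal.ofReal_add (by positivity) (by positivity), mul_comm (y ^ (1 / q))]
    exact add_le_add h2 (hfirst y)
  have hO2 : ∀ y₁ y₂, 0 < y₁ → y₁ ≤ y₂ → ENNReal.ofReal p * oneilSum p N (m y₂) ≤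
      ENNReal.ofReal (y₁ ^ (1 / q) + e y₁ ^ (1 / p) * ((y₂ - y₁) ^ (1 / q) + p)) := by
    intro y₁ y₂ h1 h12
    refine (oneilSum_le hN hp1 hNM (hm0 y₂) (hmM y₂ (h1.trans_le h12))).trans ?_
    rw [← Set.Ico_union_Ico_eq_Ico (hmanti h12) (hmM y₁ h1)]
    refine (add_le_add le_rfl (lintegral_union_le _ _ _)).trans ?_
    have ha := setLIntegral_Ico_log_le hpq hg (hm0 y₂) (hmanti h12) (he0 y₁)
      ((lintegral_mono_set (t := Set.Ioo 0 (m y₁))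
        fun s hs => ⟨(hm0 y₂).trans_le hs.1, hs.2⟩).trans (he y₁).le)
    have hb := setLIntegral_Ico_log_le hpq hg (hm0 y₁) (hmM y₁ h1) zero_le_one
      ((hfin _ fun s hs => (hm0 y₁).trans_le hs.1).trans_eq ENNReal.ofReal_one.symm)
    rw [hlog] at ha
    rw [hlogM, Real.one_rpow, one_mul] at hb
    have hc : ENNReal.ofReal (p * e y₂ ^ (1 / p)) ≤ ENNReal.ofReal (p * e y₁ ^ (1 / p)) := by
      apply ENNReal.ofReal_le_ofReal
      have := Real.rpow_le_rpow (he0 y₂) (heanti h12) (by positivity : 0 ≤ 1 / p)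
      gcongr
    refine (add_le_add ((hfirst y₂).trans hc) (add_le_add ha hb)).trans (le_of_eq ?_)
    have hd := sub_nonneg.2 h12
    have he0' := he0 y₁
    rw [← ENNReal.ofReal_add (by positivity) (by positivity),
      ← ENNReal.ofReal_add (by positivity) (by positivity)]
    congr 1; ring
  have hofp : ENNReal.ofReal p ≠ 0 := by simpa using hp
  have hfinO : ∀ y, 0 < y → oneilSum p N (m y) ≠ ∞ := by
    intro y hy h
    have := hO y hy
    rw [h, ENNReal.mul_top hofp] at this
    exact absurd this (not_le.2 ENNReal.ofReal_lt_top)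
  have htoReal : ∀ y c, 0 < y → 0 ≤ c →
      ENNReal.ofReal p * oneilSum p N (m y) ≤ ENNReal.ofReal c →
      p * (oneilSum p N (m y)).toReal ≤ c := by
    intro y c hy hc h
    have := ENNReal.toReal_le_of_le_ofReal hc h
    rwa [ENNReal.toReal_mul, ENNReal.toReal_ofReal hp.le] at this
  refine ⟨fun s hs => ?_, ?_⟩
  · have : s = m (log (M / s)) := by
      have := hs.1
      simp only [hmdef]
      rw [← Real.log_inv, Real.exp_log (by positivity)]
      field_simp
    rw [this]
    exact hfinO _ (Real.log_pos (by rw [lt_div_iff₀ hs.1, one_mul]; exact hs.2))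
  · rw [lintegral_Ioo_eq_lintegral_exp_neg hM]
    have key := hC (fun y => p * (oneilSum p N (m y)).toReal) e
      (fun y => by positivity) he0 he1
      (fun y hy => htoReal y _ hy (by
        have := sub_nonneg.2 (he1 y)
        have := he0 y
        positivity) (hO y hy))
      (fun y₁ y₂ h1 h12 => htoReal y₂ _ (h1.trans_le h12) (by
        have := sub_nonneg.2 h12
        have := he0 y₁
        positivity) (hO2 y₁ y₂ h1 h12))
    rw [ENNReal.ofReal_mul (by positivity)]
    refine le_trans (le_of_eq ?_) (mul_le_mul_right key _)
    rw [← lintegral_const_mul' _ _ ENNReal.ofReal_ne_top]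
    refine lintegral_congr fun y => ?_
    rw [← ENNReal.ofReal_mul (by positivity), ← ENNReal.ofReal_mul (by positivity)]
    congr 1
    change m y * (_ * m y ^ (γ - 1)) = _
    rw [Real.rpow_sub_one (hm0 y).ne', mul_sub, Real.exp_sub]
    have : m y ^ γ = M ^ γ / exp (γ * y) := by
      simp only [hmdef]
      rw [Real.mul_rpow hM.le (exp_pos _).le, ← Real.exp_mul, div_eq_mul_inv, ← Real.exp_neg]
      ring_nf
    rw [this]
    field_simp [(hm0 y).ne']
    ring

theorem measurable_oneilSum {N : ℝ → ℝ≥0∞} (hN : Antitone N) (p : ℝ) :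
    Measurable (oneilSum p N) := by
  have : Measurable fun z : ℝ × ℝ => min (N z.2 ^ (1 / p))
      (N z.2 * ENNReal.ofReal (z.1 ^ (1 / p - 1))) :=
    ((hN.measurable.comp measurable_snd).pow_const _).min
      ((hN.measurable.comp measurable_snd).mul (by fun_prop))
  exact Measurable.lintegral_prod_right' this

/-- Layer cake formula for a positive weight. -/
theorem setLIntegral_weight_mul_eq {X : Type*} [MeasurableSpace X] (μ : Measure X)
    {h : X → ℝ≥0∞} (hh : Measurable h) {ψ : X → ℝ} (hψ : Measurable ψ) (hψ0 : ∀ x, 0 ≤ ψ x)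
    (Ω : Set X) :
    ∫⁻ x in Ω, h x * ENNReal.ofReal (ψ x) ∂μ =
      ∫⁻ t in Set.Ioi (0 : ℝ), ∫⁻ x in {x | t < ψ x} ∩ Ω, h x ∂μ := by
  have e1 : ∫⁻ x in Ω, h x * ENNReal.ofReal (ψ x) ∂μ =
      ∫⁻ x, ENNReal.ofReal (ψ x) ∂((μ.restrict Ω).withDensity h) := by
    rw [lintegral_withDensity_eq_lintegral_mul _ hh (by fun_prop)]
    rfl
  rw [e1, lintegral_eq_lintegral_meas_lt _ (Filter.Eventually.of_forall hψ0) hψ.aemeasurable]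
  refine lintegral_congr fun t => ?_
  have hs : MeasurableSet {x | t < ψ x} := measurableSet_lt measurable_const hψ
  rw [withDensity_apply _ hs, Measure.restrict_restrict hs]

/-- Adams' exponential inequality for an integral operator whose kernel is of weak type. -/
theorem exists_adams_kernel_bound {X : Type*} [MeasurableSpace X] (μ : Measure X) [SFinite μ]
    {k : X → X → ℝ≥0∞} (hk : Measurable (Function.uncurry k)) {b p q : ℝ} (hb : 0 < b)
    (hpq : q.HolderConjugate p) (hq2 : q ≤ 2)
    (h1 : ∀ ξ D, MeasurableSet D → ∫⁻ η in D, k ξ η ∂μ ≤ ENNReal.ofReal b * μ D ^ (1 / p))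
    (h2 : ∀ η E, MeasurableSet E → ∫⁻ ξ in E, k ξ η ∂μ ≤ ENNReal.ofReal b * μ E ^ (1 / p))
    {γ M H c : ℝ} (hγ : 0 < γ) (hM : 0 < M) (hH : 0 ≤ H) (hc : 0 < c) :
    ∃ C : ℝ, 0 ≤ C ∧ ∀ h : X → ℝ≥0∞, Measurable h →
      (∀ D, MeasurableSet D → ∫⁻ x in D, h x ∂μ ≤ ENNReal.ofReal H * μ D ^ γ) →
      ∀ Ω, MeasurableSet Ω → μ Ω ≤ ENNReal.ofReal M →
      ∀ f w : X → ℝ, Measurable f → Measurable w → (∀ x, 0 ≤ f x) →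
      (∀ a, 0 < a → μ {x | a < f x} ≤ ENNReal.ofReal M) →
      (∫⁻ x, ENNReal.ofReal (f x ^ p) ∂μ ≤ 1) →
      (∀ ξ, ENNReal.ofReal (c * |w ξ|) ≤ ∫⁻ η, ENNReal.ofReal (f η) * k ξ η ∂μ) →
      ∫⁻ x in Ω, h x * ENNReal.ofReal (exp (γ * (p * c / b * |w x|) ^ q)) ∂μ ≤
        ENNReal.ofReal C := by
  have hp := hpq.symm.pos
  have hp1 := hpq.symm.lt
  have hq := hpq.pos
  obtain ⟨C, hC0, hC⟩ := exists_exp_oneilSum_bound hpq hq2 hγ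
  refine ⟨H * γ * (M ^ γ * C), by positivity, ?_⟩
  intro h hh hhH Ω hΩ hΩM f w hf hw hf0 hfM hfint hrep
  set N : ℝ → ℝ≥0∞ := fun a => μ {x | a < f x} with hNdef
  have hN : Antitone N := fun a b hab => measure_mono fun x hx => hab.trans_lt hx
  have hNint : ∫⁻ a in Set.Ioi (0 : ℝ), N a * ENNReal.ofReal (p * a ^ (p - 1)) ≤ 1 := by
    refine le_trans (le_of_eq ?_) hfint
    rw [lintegral_rpow_eq_lintegral_meas_lt_mul μ (Filter.Eventually.of_forall hf0)
      hf.aemeasurable hp, ← lintegral_const_mul' _ _ ENNReal.ofReal_ne_top]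
    refine setLIntegral_congr_fun measurableSet_Ioi fun a ha => ?_
    simp only [hNdef]
    rw [ENNReal.ofReal_mul hp.le]; ring
  obtain ⟨hfin, hbound⟩ := hC N M hN hM hfM hNint
  set Ψ : ℝ → ℝ := fun s => exp (γ * (p * (oneilSum p N s).toReal) ^ q) with hΨ
  have hΨm : Measurable Ψ := by
    have := (measurable_oneilSum hN p).ennreal_toReal
    fun_prop
  have hΨ0 : ∀ s, 0 ≤ Ψ s := fun s => (exp_pos _).le
  set ψ : X → ℝ := fun x => exp (γ * (p * c / b * |w x|) ^ q) with hψ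
  have hψm : Measurable ψ := by
    have : Measurable fun x => |w x| := hw.norm
    fun_prop
  rw [setLIntegral_weight_mul_eq μ hh hψm (fun x => (exp_pos _).le) Ω]
  have hlt : ∀ t s : ℝ, 0 < s → ENNReal.ofReal s < μ ({x | t < ψ x} ∩ Ω) → t < Ψ s := by
    intro t s hs hsE
    set E := {x | t < ψ x} ∩ Ω with hE
    have hEm : MeasurableSet E := (measurableSet_lt measurable_const hψm).inter hΩ
    have hEM : μ E ≤ ENNReal.ofReal M := (measure_mono Set.inter_subset_right).trans hΩM
    have hEfin : μ E ≠ ∞ := ne_top_of_le_ne_top ENNReal.ofReal_ne_top hEM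
    have hE0 : μ E ≠ 0 := (zero_le.trans_lt hsE).ne'
    have hsM : s < M := (ENNReal.ofReal_lt_ofReal_iff hM).1 (hsE.trans_le hEM)
    have hwm : Measurable fun x => ENNReal.ofReal (c * |w x|) := by
      have : Measurable fun x => |w x| := hw.norm
      fun_prop
    obtain ⟨x, hxE, hx⟩ := exists_le_setLAverage hE0 hEfin hwm.aemeasurable
    have hav : ∫⁻ ξ in E, ENNReal.ofReal (c * |w ξ|) ∂μ ≤
        ENNReal.ofReal b * μ E * oneilSum p N s :=
      (lintegral_mono fun ξ => hrep ξ).trans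
        (setLIntegral_kernel_le μ hk hp1 h1 h2 hf hEm hs hsE.le hEfin)
    rw [setLAverage_eq] at hx
    have hx2 : ENNReal.ofReal (c * |w x|) ≤ ENNReal.ofReal (b * (oneilSum p N s).toReal) := by
      refine hx.trans (ENNReal.div_le_of_le_mul (hav.trans (le_of_eq ?_)))
      rw [ENNReal.ofReal_mul hb.le, ENNReal.ofReal_toReal (hfin s ⟨hs, hsM⟩)]; ring
    rw [ENNReal.ofReal_le_ofReal_iff (by positivity)] at hx2
    refine hxE.1.trans_le ?_
    simp only [hψ, hΨ]
    gcongr exp (γ * ?_ ^ q)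
    calc p * c / b * |w x| = p * (c * |w x|) / b := by ring
      _ ≤ p * (b * (oneilSum p N s).toReal) / b := by gcongr
      _ = _ := by field_simp
  have hset : MeasurableSet {z : ℝ × ℝ | z.1 < Ψ z.2} :=
    measurableSet_lt measurable_fst (hΨm.comp measurable_snd)
  have hslice : ∀ t : ℝ, ∫⁻ x in {x | t < ψ x} ∩ Ω, h x ∂μ ≤ ENNReal.ofReal H *
      ∫⁻ s in Set.Ioo 0 M, {z : ℝ × ℝ | z.1 < Ψ z.2}.indicator
        (fun z => ENNReal.ofReal (γ * z.2 ^ (γ - 1))) (t, s) := by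
    intro t
    have hEm : MeasurableSet ({x | t < ψ x} ∩ Ω) :=
      (measurableSet_lt measurable_const hψm).inter hΩ
    have hEM : μ ({x | t < ψ x} ∩ Ω) ≤ ENNReal.ofReal M :=
      (measure_mono Set.inter_subset_right).trans hΩM
    have hEfin := ne_top_of_le_ne_top ENNReal.ofReal_ne_top hEM
    refine (hhH _ hEm).trans (mul_le_mul_right ?_ _)
    obtain ⟨m, hm0, hm⟩ : ∃ m : ℝ, 0 ≤ m ∧ μ ({x | t < ψ x} ∩ Ω) = ENNReal.ofReal m :=
      ⟨_, ENNReal.toReal_nonneg, (ENNReal.ofReal_toReal hEfin).symm⟩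
    have hmM : m ≤ M := by
      rw [hm] at hEM
      exact (ENNReal.ofReal_le_ofReal_iff hM.le).1 hEM
    rw [hm, ENNReal.ofReal_rpow_of_nonneg hm0 hγ.le, ← lintegral_Ioo_rpow hγ hm0]
    refine le_trans (le_of_eq ?_) (lintegral_mono_set (Set.Ioo_subset_Ioo_right hmM))
    refine setLIntegral_congr_fun measurableSet_Ioo fun s hs => ?_
    rw [Set.indicator_of_mem]
    exact hlt t s hs.1 (by
      rw [hm]; exact (ENNReal.ofReal_lt_ofReal_iff (hs.1.trans hs.2)).2 hs.2)
  refine (lintegral_mono fun t => hslice t).trans ?_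
  rw [lintegral_const_mul' _ _ ENNReal.ofReal_ne_top, lintegral_lintegral_swap]
  rotate_left
  · have : Measurable fun z : ℝ × ℝ => ENNReal.ofReal (γ * z.2 ^ (γ - 1)) := by fun_prop
    exact (this.indicator hset).aemeasurable
  rw [mul_assoc H, ENNReal.ofReal_mul hH]
  refine mul_le_mul_right ?_ _
  rw [ENNReal.ofReal_mul hγ.le]
  refine le_trans (le_of_eq ?_) (mul_le_mul_right hbound _)
  rw [← lintegral_const_mul' _ _ ENNReal.ofReal_ne_top]
  refine setLIntegral_congr_fun measurableSet_Ioo fun s hs => ?_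
  have e2 : (fun t : ℝ => {z : ℝ × ℝ | z.1 < Ψ z.2}.indicator
      (fun z => ENNReal.ofReal (γ * z.2 ^ (γ - 1))) (t, s)) =
      (Set.Iio (Ψ s)).indicator fun _ => ENNReal.ofReal (γ * s ^ (γ - 1)) := by
    ext t; simp [Set.indicator_apply]
  change ∫⁻ t in Set.Ioi 0, {z : ℝ × ℝ | z.1 < Ψ z.2}.indicator
      (fun z => ENNReal.ofReal (γ * z.2 ^ (γ - 1))) (t, s) = _
  rw [e2, lintegral_indicator_const measurableSet_Iio,
    Measure.restrict_apply measurableSet_Iio, Set.inter_comm, Set.Ioi_inter_Iio,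
    Real.volume_Ioo, sub_zero]
  have := hs.1
  rw [← ENNReal.ofReal_mul (by positivity), ← ENNReal.ofReal_mul hγ.le]
  congr 1
  ring

/-- The squared Euclidean norm of the horizontal coordinates. -/
def hZ {n : ℕ} (ξ : Heis n) : ℝ := ∑ i, ((ξ.1 i) ^ 2 + (ξ.2.1 i) ^ 2)

/-- The rotation of all complex coordinates `x + i y` by a common angle. -/
def hRot {n : ℕ} (θ : ℝ) (ξ : Heis n) : Heis n :=
  (cos θ • ξ.1 + sin θ • ξ.2.1, -sin θ • ξ.1 + cos θ • ξ.2.1, ξ.2.2)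

/-- The anisotropic dilation of the Heisenberg group. -/
def hDil {n : ℕ} (s : ℝ) (ξ : Heis n) : Heis n := (s • ξ.1, s • ξ.2.1, s ^ 2 * ξ.2.2)


section

variable {n : ℕ}

theorem hZ_nonneg (ξ : Heis n) : 0 ≤ hZ ξ := Finset.sum_nonneg fun i _ => by positivity

@[fun_prop]
theorem continuous_hZ : Continuous (hZ : Heis n → ℝ) := by unfold hZ; fun_prop

@[fun_prop]
theorem measurable_hZ : Measurable (hZ : Heis n → ℝ) := continuous_hZ.measurable

theorem hZ_hRot (θ : ℝ) (ξ : Heis n) : hZ (hRot θ ξ) = hZ ξ := by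
  unfold hZ hRot
  refine Finset.sum_congr rfl fun i _ => ?_
  simp only [Pi.add_apply, Pi.smul_apply, smul_eq_mul]
  linear_combination ((ξ.1 i) ^ 2 + (ξ.2.1 i) ^ 2) * sin_sq_add_cos_sq θ

theorem hZ_hDil (s : ℝ) (ξ : Heis n) : hZ (hDil s ξ) = s ^ 2 * hZ ξ := by
  unfold hZ hDil
  rw [Finset.mul_sum]
  refine Finset.sum_congr rfl fun i _ => ?_
  simp only [Pi.smul_apply, smul_eq_mul]
  ring

theorem hRot_hRot (a b : ℝ) (ξ : Heis n) : hRot a (hRot b ξ) = hRot (a + b) ξ := by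
  unfold hRot
  refine Prod.ext ?_ (Prod.ext ?_ rfl) <;> ext i <;>
    simp only [Pi.add_apply, Pi.smul_apply, smul_eq_mul, cos_add, sin_add] <;> ring

theorem hRot_zero (ξ : Heis n) : hRot 0 ξ = ξ := by
  unfold hRot; simp

@[fun_prop]
theorem measurable_hRot_comp {X : Type*} [MeasurableSpace X] {θ : X → ℝ} {f : X → Heis n}
    (hθ : Measurable θ) (hf : Measurable f) : Measurable fun x => hRot (θ x) (f x) := by
  unfold hRot; fun_prop

instance isAddHaarMeasure_volume_heis : (volume : Measure (Heis n)).IsAddHaarMeasure := by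
  have : (volume : Measure ((Fin n → ℝ) × ℝ)).IsAddHaarMeasure :=
    Measure.prod.instIsAddHaarMeasure volume volume
  exact Measure.prod.instIsAddHaarMeasure volume volume

/-- `hRot` as a linear map. -/
def hRotLin (θ : ℝ) : Heis n →ₗ[ℝ] Heis n where
  toFun := hRot θ
  map_add' ξ η := by
    unfold hRot
    refine Prod.ext ?_ (Prod.ext ?_ rfl) <;> ext i <;> simp <;> ring
  map_smul' c ξ := by
    unfold hRot
    refine Prod.ext ?_ (Prod.ext ?_ ?_)
    · ext i; simp; ring
    · ext i; simp; ring
    · simp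

theorem isOpen_unitSet : IsOpen {ξ : Heis n | hZ ξ + ξ.2.2 ^ 2 < 1} :=
  isOpen_lt (by fun_prop) continuous_const

theorem volume_unitSet_lt_top : volume {ξ : Heis n | hZ ξ + ξ.2.2 ^ 2 < 1} < ∞ := by
  refine (measure_mono (fun ξ hξ => ?_)).trans_lt
    (measure_closedBall_lt_top (μ := volume) (x := (0 : Heis n)) (r := 1))
  have hξ' : hZ ξ + ξ.2.2 ^ 2 < 1 := hξ
  have hz : ∀ i, ξ.1 i ^ 2 + ξ.2.1 i ^ 2 ≤ hZ ξ := fun i =>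
    Finset.single_le_sum (f := fun i => ξ.1 i ^ 2 + ξ.2.1 i ^ 2) (fun i _ => by positivity)
      (Finset.mem_univ i)
  have h0 := hZ_nonneg ξ
  rw [mem_closedBall_zero_iff, Prod.norm_def, Prod.norm_def]
  refine max_le ?_ (max_le ?_ ?_)
  · refine (pi_norm_le_iff_of_nonneg zero_le_one).2 fun i => ?_
    rw [Real.norm_eq_abs, ← sq_le_one_iff_abs_le_one]
    nlinarith [hz i, sq_nonneg (ξ.2.1 i), sq_nonneg ξ.2.2]
  · refine (pi_norm_le_iff_of_nonneg zero_le_one).2 fun i => ?_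
    rw [Real.norm_eq_abs, ← sq_le_one_iff_abs_le_one]
    nlinarith [hz i, sq_nonneg (ξ.1 i), sq_nonneg ξ.2.2]
  · rw [Real.norm_eq_abs, ← sq_le_one_iff_abs_le_one]
    nlinarith

theorem measurePreserving_hRot (θ : ℝ) :
    MeasurePreserving (hRot θ : Heis n → Heis n) volume volume := by
  refine ⟨measurable_hRot_comp measurable_const measurable_id, ?_⟩
  have hdet : LinearMap.det (hRotLin θ : Heis n →ₗ[ℝ] Heis n) ≠ 0 := by
    have h : (hRotLin θ : Heis n →ₗ[ℝ] Heis n) ∘ₗ hRotLin (-θ) = LinearMap.id := by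
      refine LinearMap.ext fun ξ => ?_
      change hRot θ (hRot (-θ) ξ) = ξ
      rw [hRot_hRot, add_neg_cancel, hRot_zero]
    intro h0
    have := congrArg LinearMap.det h
    rw [LinearMap.det_comp, h0, zero_mul, LinearMap.det_id] at this
    exact zero_ne_one this
  have hinv : (hRotLin θ : Heis n →ₗ[ℝ] Heis n) ⁻¹' {ξ | hZ ξ + ξ.2.2 ^ 2 < 1} =
      {ξ | hZ ξ + ξ.2.2 ^ 2 < 1} := by
    ext ξ
    change hZ (hRot θ ξ) + _ < 1 ↔ _
    rw [hZ_hRot]; rfl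
  have hpos : volume {ξ : Heis n | hZ ξ + ξ.2.2 ^ 2 < 1} ≠ 0 := by
    refine (isOpen_unitSet.measure_pos volume ⟨0, ?_⟩).ne'
    simp [hZ]
  have h1 := Measure.addHaar_preimage_linearMap volume hdet {ξ : Heis n | hZ ξ + ξ.2.2 ^ 2 < 1}
  rw [hinv] at h1
  have h2 : ENNReal.ofReal |(LinearMap.det (hRotLin θ : Heis n →ₗ[ℝ] Heis n))⁻¹| = 1 := by
    have := (ENNReal.mul_left_inj hpos volume_unitSet_lt_top.ne).1 ((one_mul _).trans h1)
    exact this.symm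
  have h3 := Measure.map_linearMap_addHaar_eq_smul_addHaar volume hdet
  rw [h2, one_smul] at h3
  exact h3

/-- Integrals of periodic functions over a period do not depend on the starting point. -/
theorem setLIntegral_periodic {g : ℝ → ℝ≥0∞} {T : ℝ} (hT : 0 < T) (hg : Function.Periodic g T)
    (θ : ℝ) : ∫⁻ ψ in Set.Ioc 0 T, g (θ + ψ) = ∫⁻ ψ in Set.Ioc 0 T, g ψ := by
  have e1 : ∫⁻ ψ in Set.Ioc 0 T, g (θ + ψ) = ∫⁻ ψ in Set.Ioc θ (θ + T), g ψ := by
    rw [← lintegral_indicator measurableSet_Ioc, ← lintegral_indicator measurableSet_Ioc,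
      ← lintegral_add_left_eq_self ((Set.Ioc θ (θ + T)).indicator g) θ]
    refine lintegral_congr fun ψ => ?_
    simp [Set.indicator_apply]
  have e2 := (isAddFundamentalDomain_Ioc hT θ).setLIntegral_eq (isAddFundamentalDomain_Ioc hT 0) g
    (fun a x => by
      obtain ⟨k, hk⟩ := a.2
      have : (a +ᵥ x : ℝ) = x + k • T := by
        rw [add_comm]; exact congrArg (· + x) hk.symm
      rw [this]
      exact hg.zsmul k x)
  rw [e1, e2, zero_add]

/-- A rotation by a rotation-invariant angle preserves integrals. -/
theorem lintegral_hRot_twist {θ : Heis n → ℝ} (hθ : Measurable θ)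
    (hinv : ∀ ψ ξ, θ (hRot ψ ξ) = θ ξ) {F : Heis n → ℝ≥0∞} (hF : Measurable F) :
    ∫⁻ ξ, F (hRot (θ ξ) ξ) = ∫⁻ ξ, F ξ := by
  have hper : ∀ ξ : Heis n, Function.Periodic (fun ψ => F (hRot ψ ξ)) (2 * π) := by
    intro ξ ψ
    simp only [hRot, cos_add_two_pi, sin_add_two_pi]
  have htw : Measurable fun ξ : Heis n => F (hRot (θ ξ) ξ) :=
    hF.comp (measurable_hRot_comp hθ measurable_id)
  have h1 : ∀ ψ, ∫⁻ ξ, F (hRot (θ ξ) ξ) = ∫⁻ ξ, F (hRot (θ ξ + ψ) ξ) := by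
    intro ψ
    rw [← (measurePreserving_hRot ψ).lintegral_comp htw]
    refine lintegral_congr fun ξ => ?_
    rw [hinv, hRot_hRot]
  have h2 : ∀ ψ, ∫⁻ ξ, F ξ = ∫⁻ ξ, F (hRot ψ ξ) := fun ψ =>
    ((measurePreserving_hRot ψ).lintegral_comp hF).symm
  have h3 : ENNReal.ofReal (2 * π) * ∫⁻ ξ, F (hRot (θ ξ) ξ) =
      ENNReal.ofReal (2 * π) * ∫⁻ ξ, F ξ := by
    calc ENNReal.ofReal (2 * π) * ∫⁻ ξ, F (hRot (θ ξ) ξ)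
        = ∫⁻ ψ in Set.Ioc 0 (2 * π), ∫⁻ ξ, F (hRot (θ ξ + ψ) ξ) := by
          simp_rw [← h1]
          rw [setLIntegral_const, Real.volume_Ioc, sub_zero, mul_comm]
      _ = ∫⁻ ξ, ∫⁻ ψ in Set.Ioc 0 (2 * π), F (hRot (θ ξ + ψ) ξ) := by
          rw [lintegral_lintegral_swap]
          have : Measurable fun z : ℝ × Heis n => F (hRot (θ z.2 + z.1) z.2) :=
            hF.comp (measurable_hRot_comp ((hθ.comp measurable_snd).add measurable_fst)
              measurable_snd)
          exact this.aemeasurable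
      _ = ∫⁻ ξ, ∫⁻ ψ in Set.Ioc 0 (2 * π), F (hRot ψ ξ) :=
          lintegral_congr fun ξ => setLIntegral_periodic (by positivity) (hper ξ) _
      _ = ∫⁻ ψ in Set.Ioc 0 (2 * π), ∫⁻ ξ, F (hRot ψ ξ) := by
          rw [lintegral_lintegral_swap]
          have : Measurable fun z : Heis n × ℝ => F (hRot z.2 z.1) :=
            hF.comp (measurable_hRot_comp measurable_snd measurable_fst)
          exact this.aemeasurable
      _ = _ := by
          simp_rw [← h2]
          rw [setLIntegral_const, Real.volume_Ioc, sub_zero, mul_comm]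
  exact (ENNReal.mul_right_inj (by simp [Real.pi_pos]) ENNReal.ofReal_ne_top).1 h3

/-- `hDil` as a linear map. -/
def hDilLin (s : ℝ) : Heis n →ₗ[ℝ] Heis n :=
  (s • LinearMap.id).prodMap ((s • LinearMap.id).prodMap (s ^ 2 • LinearMap.id))

theorem det_hDilLin (s : ℝ) :
    LinearMap.det (hDilLin s : Heis n →ₗ[ℝ] Heis n) = s ^ (2 * n + 2) := by
  rw [hDilLin, LinearMap.det_prodMap, LinearMap.det_prodMap, LinearMap.det_smul,
    LinearMap.det_smul]
  simp
  ring

theorem measurable_hDil (s : ℝ) : Measurable (hDil s : Heis n → Heis n) := by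
  unfold hDil; fun_prop

theorem map_hDil {s : ℝ} (hs : 0 < s) :
    Measure.map (hDil s : Heis n → Heis n) volume =
      ENNReal.ofReal ((s ^ (2 * n + 2))⁻¹) • volume := by
  have hdet : LinearMap.det (hDilLin s : Heis n →ₗ[ℝ] Heis n) ≠ 0 := by
    rw [det_hDilLin]; positivity
  have h := Measure.map_linearMap_addHaar_eq_smul_addHaar volume hdet
  rw [det_hDilLin, abs_of_pos (by positivity)] at h
  exact h

theorem lintegral_hDil {s : ℝ} (hs : 0 < s) {F : Heis n → ℝ≥0∞} (hF : Measurable F) :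
    ∫⁻ ξ, F (hDil s ξ) = ENNReal.ofReal ((s ^ (2 * n + 2))⁻¹) * ∫⁻ ξ, F ξ := by
  rw [← lintegral_map hF (measurable_hDil s), map_hDil hs, lintegral_smul_measure, smul_eq_mul]

theorem volume_preimage_hDil {s : ℝ} (hs : 0 < s) {E : Set (Heis n)} (hE : MeasurableSet E) :
    volume (hDil s ⁻¹' E) = ENNReal.ofReal ((s ^ (2 * n + 2))⁻¹) * volume E := by
  rw [← Measure.map_apply (measurable_hDil s) hE, map_hDil hs, Measure.smul_apply, smul_eq_mul]

@[fun_prop]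
theorem continuous_hMul_comp {X : Type*} [TopologicalSpace X] {f g : X → Heis n}
    (hf : Continuous f) (hg : Continuous g) : Continuous fun x => hMul (f x) (g x) := by
  unfold hMul; fun_prop

theorem measurePreserving_hMul (a : Heis n) :
    MeasurePreserving (hMul a : Heis n → Heis n) volume volume := by
  have h3 : ∀ x y : Fin n → ℝ, Measure.map (fun t : ℝ =>
      a.2.2 + t + 2 * ((∑ i, a.2.1 i * x i) - ∑ i, a.1 i * y i)) volume = volume := by
    intro x y
    have := (measurePreserving_add_left (volume : Measure ℝ)
      (a.2.2 + 2 * ((∑ i, a.2.1 i * x i) - ∑ i, a.1 i * y i))).map_eq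
    refine Eq.trans ?_ this
    congr 1
    ext t
    ring
  have h2 : ∀ x : Fin n → ℝ, MeasurePreserving (fun z : (Fin n → ℝ) × ℝ =>
      (a.2.1 + z.1, a.2.2 + z.2 + 2 * ((∑ i, a.2.1 i * x i) - ∑ i, a.1 i * z.1 i)))
      (volume.prod volume) (volume.prod volume) := by
    intro x
    refine MeasurePreserving.skew_product (f := fun y => a.2.1 + y)
      (g := fun (y : Fin n → ℝ) (t : ℝ) =>
        a.2.2 + t + 2 * ((∑ i, a.2.1 i * x i) - ∑ i, a.1 i * y i))
      (measurePreserving_add_left volume a.2.1) ?_ (Filter.Eventually.of_forall fun y => h3 x y)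
    unfold Function.uncurry; fun_prop
  have h1 : MeasurePreserving (fun z : (Fin n → ℝ) × ((Fin n → ℝ) × ℝ) =>
      (a.1 + z.1, (a.2.1 + z.2.1,
        a.2.2 + z.2.2 + 2 * ((∑ i, a.2.1 i * z.1 i) - ∑ i, a.1 i * z.2.1 i))))
      (volume.prod (volume.prod volume)) (volume.prod (volume.prod volume)) := by
    refine MeasurePreserving.skew_product (f := fun y => a.1 + y)
      (g := fun (x : Fin n → ℝ) (z : (Fin n → ℝ) × ℝ) => (a.2.1 + z.1,
        a.2.2 + z.2 + 2 * ((∑ i, a.2.1 i * x i) - ∑ i, a.1 i * z.1 i)))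
      (measurePreserving_add_left volume a.1) ?_
      (Filter.Eventually.of_forall fun x => (h2 x).map_eq)
    unfold Function.uncurry; fun_prop
  exact h1

theorem hMul_neg_hMul (a ξ : Heis n) : hMul (-a) (hMul a ξ) = ξ := by
  unfold hMul
  refine Prod.ext ?_ (Prod.ext ?_ ?_)
  · simp
  · simp
  · simp only [Prod.fst_neg, Prod.snd_neg, Pi.neg_apply, Pi.add_apply, neg_mul,
      Finset.sum_neg_distrib, mul_add, Finset.sum_add_distrib]
    have : ∑ i, a.2.1 i * a.1 i = ∑ i, a.1 i * a.2.1 i :=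
      Finset.sum_congr rfl fun i _ => mul_comm _ _
    linarith

theorem hMul_hMul_neg (a ξ : Heis n) : hMul a (hMul (-a) ξ) = ξ := by
  simpa using hMul_neg_hMul (-a) ξ

/-- The reciprocal of the distance-like gauge whose powers give the representation kernel. -/
def hV {n : ℕ} (ξ : Heis n) : ℝ := √(hZ ξ / (hZ ξ ^ 2 + ξ.2.2 ^ 2))

@[fun_prop]
theorem measurable_hV : Measurable (hV : Heis n → ℝ) := by unfold hV; fun_prop

theorem hV_nonneg (ξ : Heis n) : 0 ≤ hV ξ := Real.sqrt_nonneg _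

theorem hV_hRot (θ : ℝ) (ξ : Heis n) : hV (hRot θ ξ) = hV ξ := by
  unfold hV; rw [hZ_hRot]; rfl

theorem hV_hDil {s : ℝ} (hs : 0 < s) (ξ : Heis n) : hV (hDil s ξ) = hV ξ / s := by
  unfold hV
  rw [hZ_hDil]
  have : (hDil s ξ).2.2 = s ^ 2 * ξ.2.2 := rfl
  rw [this, show s ^ 2 * hZ ξ / ((s ^ 2 * hZ ξ) ^ 2 + (s ^ 2 * ξ.2.2) ^ 2) =
    hZ ξ / (hZ ξ ^ 2 + ξ.2.2 ^ 2) / s ^ 2 by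
      rw [div_div, show (s ^ 2 * hZ ξ) ^ 2 + (s ^ 2 * ξ.2.2) ^ 2 =
        s ^ 2 * ((hZ ξ ^ 2 + ξ.2.2 ^ 2) * s ^ 2) by ring, mul_div_mul_left _ _ (by positivity)]]
  rw [Real.sqrt_div' _ (by positivity), Real.sqrt_sq hs.le]

theorem hZ_neg (ξ : Heis n) : hZ (-ξ) = hZ ξ := by simp [hZ]

theorem hV_neg (ξ : Heis n) : hV (-ξ) = hV ξ := by
  unfold hV; rw [hZ_neg]; simp

theorem volume_lt_hV {t : ℝ} (ht : 0 < t) :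
    volume {ξ : Heis n | t < hV ξ} =
      ENNReal.ofReal ((t ^ (2 * n + 2))⁻¹) * volume {ξ : Heis n | 1 < hV ξ} := by
  rw [← volume_preimage_hDil ht (measurableSet_lt measurable_const measurable_hV)]
  congr 1
  ext ξ
  simp only [Set.mem_ofPred_eq, Set.mem_preimage]
  rw [hV_hDil ht, lt_div_iff₀ ht, one_mul]

theorem setLIntegral_Ioi_exp_neg (u : ℝ) :
    ∫⁻ τ in Set.Ioi u, ENNReal.ofReal (exp (-τ)) = ENNReal.ofReal (exp (-u)) := by
  rw [← integral_exp_neg_Ioi, ofReal_integral_eq_lintegral_ofReal]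
  · exact integrableOn_exp_neg_Ioi u
  · exact Filter.Eventually.of_forall fun x => (exp_pos _).le

theorem ae_hZ_pos (hn : 1 ≤ n) : ∀ᵐ ξ : Heis n, 0 < hZ ξ := by
  have : Nonempty (Fin n) := ⟨⟨0, hn⟩⟩
  have h0 : volume (({0} : Set (Fin n → ℝ)) ×ˢ (Set.univ : Set ((Fin n → ℝ) × ℝ))) = 0 := by
    rw [Measure.volume_eq_prod, Measure.prod_prod, measure_singleton, zero_mul]
  refine (measure_mono_null (fun ξ hξ => ?_) h0 : _)
  refine ⟨?_, trivial⟩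
  have hξ' : ¬ 0 < hZ ξ := hξ
  have h1 : hZ ξ = 0 := le_antisymm (not_lt.1 hξ') (hZ_nonneg ξ)
  rw [hZ, Finset.sum_eq_zero_iff_of_nonneg (fun i _ => by positivity)] at h1
  ext i
  have := h1 i (Finset.mem_univ i)
  have h2 : ξ.1 i ^ 2 = 0 := by nlinarith [sq_nonneg (ξ.1 i), sq_nonneg (ξ.2.1 i)]
  simpa using h2

theorem lintegral_exp_gauge (hn : 1 ≤ n) :
    ∫⁻ ξ : Heis n, ENNReal.ofReal (exp (-(hZ ξ + ξ.2.2 ^ 2 / hZ ξ))) =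
      ENNReal.ofReal (Gamma (n + 2)) * volume {ξ : Heis n | 1 < hV ξ} := by
  have hset : MeasurableSet {z : Heis n × ℝ | 1 < z.2 * hV z.1 ^ 2} :=
    measurableSet_lt measurable_const (by fun_prop)
  have e1 : ∀ᵐ ξ : Heis n, ENNReal.ofReal (exp (-(hZ ξ + ξ.2.2 ^ 2 / hZ ξ))) =
      ∫⁻ τ in Set.Ioi (0 : ℝ), {z : Heis n × ℝ | 1 < z.2 * hV z.1 ^ 2}.indicator
        (fun z => ENNReal.ofReal (exp (-z.2))) (ξ, τ) := by
    filter_upwards [ae_hZ_pos hn] with ξ hξ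
    have hu : 0 < hZ ξ + ξ.2.2 ^ 2 / hZ ξ := by positivity
    have hv : hV ξ ^ 2 = (hZ ξ + ξ.2.2 ^ 2 / hZ ξ)⁻¹ := by
      rw [hV, Real.sq_sqrt (by positivity)]
      field_simp
    rw [← setLIntegral_Ioi_exp_neg, ← lintegral_indicator measurableSet_Ioi,
      ← lintegral_indicator measurableSet_Ioi]
    refine lintegral_congr fun τ => ?_
    have hiff : 1 < τ * hV ξ ^ 2 ↔ hZ ξ + ξ.2.2 ^ 2 / hZ ξ < τ := by
      rw [hv, ← div_eq_mul_inv, one_lt_div hu]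
    simp only [Set.indicator_apply, Set.mem_Ioi, Set.mem_ofPred_eq, hiff]
    split_ifs with h1 h2 h2
    · rfl
    · exact absurd (hu.trans h1) h2
    · rfl
    · rfl
  rw [lintegral_congr_ae e1, lintegral_lintegral_swap]
  rotate_left
  · have : Measurable fun z : Heis n × ℝ => ENNReal.ofReal (exp (-z.2)) := by fun_prop
    exact (this.indicator hset).aemeasurable
  have e2 : ∀ τ ∈ Set.Ioi (0 : ℝ), ∫⁻ ξ : Heis n, {z : Heis n × ℝ | 1 < z.2 * hV z.1 ^ 2}.indicator
      (fun z => ENNReal.ofReal (exp (-z.2))) (ξ, τ) =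
      ENNReal.ofReal (exp (-τ) * τ ^ ((n + 2 : ℝ) - 1)) * volume {ξ : Heis n | 1 < hV ξ} := by
    intro τ hτ
    have hτ0 : 0 < τ := hτ
    have hs : {ξ : Heis n | 1 < τ * hV ξ ^ 2} = {ξ | (√τ)⁻¹ < hV ξ} := by
      ext ξ
      simp only [Set.mem_ofPred_eq]
      have hsq : 0 < √τ := Real.sqrt_pos.2 hτ0
      rw [inv_lt_iff_one_lt_mul₀ hsq]
      have : τ * hV ξ ^ 2 = (hV ξ * √τ) ^ 2 := by rw [mul_pow, Real.sq_sqrt hτ0.le]; ring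
      rw [this, one_lt_sq_iff₀ (by have := hV_nonneg ξ; positivity), mul_comm]
    have : (fun ξ : Heis n => {z : Heis n × ℝ | 1 < z.2 * hV z.1 ^ 2}.indicator
      (fun z => ENNReal.ofReal (exp (-z.2))) (ξ, τ)) = {ξ : Heis n | 1 < τ * hV ξ ^ 2}.indicator
        fun _ => ENNReal.ofReal (exp (-τ)) := by
      ext ξ; simp [Set.indicator_apply]
    rw [this, lintegral_indicator_const (measurableSet_lt measurable_const (by fun_prop)), hs,
      volume_lt_hV (by positivity), ← mul_assoc, ← ENNReal.ofReal_mul (exp_pos _).le]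
    congr 3
    rw [inv_pow, inv_inv, show 2 * n + 2 = 2 * (n + 1) by ring, pow_mul, Real.sq_sqrt hτ0.le,
      show (n + 2 : ℝ) - 1 = ((n + 1 : ℕ) : ℝ) by push_cast; ring, Real.rpow_natCast]
  rw [setLIntegral_congr_fun measurableSet_Ioi e2, lintegral_mul_const _ (by fun_prop)]
  congr 1
  have hn2 : (0 : ℝ) < n + 2 := by positivity
  rw [Real.Gamma_eq_integral hn2, ofReal_integral_eq_lintegral_ofReal
    (Real.GammaIntegral_convergent hn2)]
  refine (ae_restrict_mem measurableSet_Ioi).mono fun t ht => ?_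
  have : 0 < t := ht
  simp only [Pi.zero_apply]; positivity

theorem lintegral_gaussian_div {Z : ℝ} (hZ0 : 0 < Z) :
    ∫⁻ t : ℝ, ENNReal.ofReal (exp (-(Z + t ^ 2 / Z))) =
      ENNReal.ofReal (√π * √Z * exp (-Z)) := by
  have h1 : ∀ t : ℝ, exp (-(Z + t ^ 2 / Z)) = exp (-Z) * exp (-Z⁻¹ * t ^ 2) := by
    intro t; rw [← Real.exp_add]; congr 1; field_simp; ring
  simp_rw [h1]
  rw [← ofReal_integral_eq_lintegral_ofReal
    ((integrable_exp_neg_mul_sq (by positivity)).const_mul _)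
    (Filter.Eventually.of_forall fun t => by positivity), integral_const_mul, integral_gaussian,
    div_inv_eq_mul, Real.sqrt_mul pi_pos.le]
  congr 1; ring

theorem lintegral_radial (hn : 1 ≤ n) :
    ∫⁻ z : (Fin n → ℝ) × (Fin n → ℝ), ENNReal.ofReal
      (√π * √(∑ i, (z.1 i ^ 2 + z.2 i ^ 2)) * exp (-∑ i, (z.1 i ^ 2 + z.2 i ^ 2))) =
      ENNReal.ofReal (√π * (n * π ^ n * Gamma (n + 1 / 2) / n.factorial)) := by
  set φ : ℝ → ℝ := fun r => √π * r * exp (-r ^ 2) with hφ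
  have e1 : ∫⁻ z : (Fin n → ℝ) × (Fin n → ℝ), ENNReal.ofReal
      (√π * √(∑ i, (z.1 i ^ 2 + z.2 i ^ 2)) * exp (-∑ i, (z.1 i ^ 2 + z.2 i ^ 2))) =
      ∫⁻ v : EuclideanSpace ℝ (Fin n ⊕ Fin n), ENNReal.ofReal (φ ‖v‖) := by
    rw [← (PiLp.volume_preserving_toLp (Fin n ⊕ Fin n)).lintegral_comp (by fun_prop),
      ← (volume_measurePreserving_sumPiEquivProdPi
        (fun _ : Fin n ⊕ Fin n => ℝ)).lintegral_comp (by fun_prop)]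
    refine lintegral_congr fun v => ?_
    have : ∑ i, (v (Sum.inl i) ^ 2 + v (Sum.inr i) ^ 2) = ‖WithLp.toLp 2 v‖ ^ 2 := by
      rw [EuclideanSpace.norm_sq_eq, Fintype.sum_sum_type, Finset.sum_add_distrib]
      simp
    change ENNReal.ofReal (√π * √(∑ i, (v (Sum.inl i) ^ 2 + v (Sum.inr i) ^ 2)) *
      exp (-∑ i, (v (Sum.inl i) ^ 2 + v (Sum.inr i) ^ 2))) = _
    rw [this, Real.sqrt_sq (norm_nonneg _)]
  have : Nonempty (Fin n) := ⟨⟨0, hn⟩⟩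
  have hdim : Module.finrank ℝ (EuclideanSpace ℝ (Fin n ⊕ Fin n)) = 2 * n := by
    simp; ring
  have hrad : ∀ r ∈ Set.Ioi (0 : ℝ), r ^ (2 * n - 1) * φ r =
      √π * (r ^ ((2 * n : ℕ) : ℝ) * exp (-r ^ (2 : ℝ))) := by
    intro r _
    simp only [hφ]
    rw [Real.rpow_natCast, show r ^ (2 : ℝ) = r ^ 2 by exact_mod_cast Real.rpow_natCast r 2]
    obtain ⟨k, hk⟩ : ∃ k, 2 * n = k + 1 := ⟨2 * n - 1, by omega⟩
    rw [hk, Nat.add_sub_cancel, pow_succ]; ring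
  have hint : IntegrableOn (fun r : ℝ => r ^ (2 * n - 1) * φ r) (Set.Ioi 0) := by
    refine IntegrableOn.congr_fun ?_ (fun r hr => (hrad r hr).symm) measurableSet_Ioi
    have hq : (-1 : ℝ) < ((2 * n : ℕ) : ℝ) := by
      have : (0 : ℝ) ≤ ((2 * n : ℕ) : ℝ) := by positivity
      linarith
    exact (integrableOn_rpow_mul_exp_neg_rpow hq (p := 2) (by norm_num)).const_mul _
  have hint2 : Integrable fun v : EuclideanSpace ℝ (Fin n ⊕ Fin n) => φ ‖v‖ := by
    rw [integrable_fun_norm_addHaar, hdim]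
    simpa using hint
  rw [e1, ← ofReal_integral_eq_lintegral_ofReal hint2 (Filter.Eventually.of_forall fun v => by
    simp only [hφ, Pi.zero_apply]; positivity), integral_fun_norm_addHaar, hdim]
  simp only [smul_eq_mul, nsmul_eq_mul]
  rw [setIntegral_congr_fun measurableSet_Ioi hrad, integral_const_mul,
    integral_rpow_mul_exp_neg_rpow (by norm_num) (by
      have : (0 : ℝ) ≤ ((2 * n : ℕ) : ℝ) := by positivity
      linarith), Measure.real, InnerProductSpace.volume_ball_of_dim_even (k := n) hdim]
  congr 1
  rw [ENNReal.ofReal_one, one_pow, one_mul, ENNReal.toReal_ofReal (by positivity)]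
  push_cast
  rw [show (2 * (n : ℝ) + 1) / 2 = n + 1 / 2 by ring]
  ring

theorem volume_one_lt_hV (hn : 1 ≤ n) :
    volume {ξ : Heis n | 1 < hV ξ} = ENNReal.ofReal (sigmaQ n / (2 * n + 2)) := by
  have : Nonempty (Fin n) := ⟨⟨0, hn⟩⟩
  have h1 := lintegral_exp_gauge hn
  have h2 : ∫⁻ ξ : Heis n, ENNReal.ofReal (exp (-(hZ ξ + ξ.2.2 ^ 2 / hZ ξ))) =
      ENNReal.ofReal (√π * (n * π ^ n * Gamma (n + 1 / 2) / n.factorial)) := by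
    rw [← lintegral_radial hn, Measure.volume_eq_prod (Fin n → ℝ) (Fin n → ℝ),
      Measure.volume_eq_prod (Fin n → ℝ) ((Fin n → ℝ) × ℝ),
      lintegral_prod _ (by fun_prop), lintegral_prod _ (by fun_prop)]
    refine lintegral_congr_ae ?_
    have hx0 : ∀ᵐ x : Fin n → ℝ, x ≠ 0 := by simp [ae_iff]
    filter_upwards [hx0] with x hx
    rw [Measure.volume_eq_prod, lintegral_prod _ (by fun_prop)]
    refine lintegral_congr fun y => ?_
    have hpos : 0 < ∑ i, (x i ^ 2 + y i ^ 2) := by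
      obtain ⟨i, hi⟩ := Function.ne_iff.1 hx
      refine Finset.sum_pos' (fun i _ => by positivity) ⟨i, Finset.mem_univ i, ?_⟩
      have : x i ≠ 0 := hi
      positivity
    exact lintegral_gaussian_div hpos
  rw [h1] at h2
  have hG : 0 < Gamma ((n : ℝ) + 2) := Real.Gamma_pos_of_pos (by positivity)
  refine (ENNReal.mul_right_inj (a := ENNReal.ofReal (Gamma ((n : ℝ) + 2)))
    (by simpa using hG) ENNReal.ofReal_ne_top).1 ?_
  rw [h2, ← ENNReal.ofReal_mul hG.le]
  congr 1
  rw [sigmaQ, omegaSphere, Real.Gamma_one_half_eq, show (n : ℝ) + 2 = ((n + 1 : ℕ) : ℝ) + 1 by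
    push_cast; ring, Real.Gamma_nat_eq_factorial]
  obtain ⟨k, rfl⟩ : ∃ k, n = k + 1 := ⟨n - 1, by omega⟩
  rw [Nat.add_sub_cancel]
  simp only [Nat.factorial_succ]
  push_cast
  field_simp

theorem fderiv_horizontal (w : Heis n → ℝ) (ξ : Heis n) (a b : Fin n → ℝ) :
    fderiv ℝ w ξ (a, b, 2 * ∑ i, (ξ.2.1 i * a i - ξ.1 i * b i)) =
      ∑ i, (a i * Xd w i ξ + b i * Yd w i ξ) := by
  have h : ((a, b, 2 * ∑ i, (ξ.2.1 i * a i - ξ.1 i * b i)) : Heis n) =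
      ∑ i, (a i • ((Pi.single i 1, 0, 2 * ξ.2.1 i) : Heis n) +
        b i • ((0, Pi.single i 1, -(2 * ξ.1 i)) : Heis n)) := by
    refine Prod.ext ?_ (Prod.ext ?_ ?_)
    · ext j; simp [Prod.fst_sum, Finset.sum_apply, Pi.single_apply]
    · ext j; simp [Prod.fst_sum, Prod.snd_sum, Finset.sum_apply, Pi.single_apply]
    · simp only [Prod.snd_sum, Prod.snd_add, Prod.smul_snd, smul_eq_mul, Finset.mul_sum]
      exact Finset.sum_congr rfl fun i _ => by ring
  rw [h, map_sum]
  refine Finset.sum_congr rfl fun i _ => ?_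
  have h1 : ((Pi.single i 1, 0, 2 * ξ.2.1 i) : Heis n) =
      (Pi.single i 1, 0, 0) + (2 * ξ.2.1 i) • ((0, 0, 1) : Heis n) := by
    refine Prod.ext ?_ (Prod.ext ?_ ?_) <;> simp
  have h2 : ((0, Pi.single i 1, -(2 * ξ.1 i)) : Heis n) =
      (0, Pi.single i 1, 0) + (-(2 * ξ.1 i)) • ((0, 0, 1) : Heis n) := by
    refine Prod.ext ?_ (Prod.ext ?_ ?_) <;> simp
  rw [h1, h2]
  simp only [map_add, map_smul, smul_eq_mul, Xd, Yd]
  ring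

theorem abs_fderiv_horizontal_le (w : Heis n → ℝ) (ξ : Heis n) (a b : Fin n → ℝ) :
    |fderiv ℝ w ξ (a, b, 2 * ∑ i, (ξ.2.1 i * a i - ξ.1 i * b i))| ≤
      √(∑ i, (a i ^ 2 + b i ^ 2)) * hGradNorm w ξ := by
  rw [fderiv_horizontal, hGradNorm, ← Real.sqrt_mul (Finset.sum_nonneg fun i _ => by positivity)]
  refine Real.abs_le_sqrt ?_
  have := Finset.sum_mul_sq_le_sq_mul_sq Finset.univ
    (Sum.elim a b) (Sum.elim (fun i => Xd w i ξ) fun i => Yd w i ξ)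
  simpa [Fintype.sum_sum_type, ← Finset.sum_add_distrib] using this

theorem continuous_hGradNorm {w : Heis n → ℝ} (hw : ContDiff ℝ 1 w) :
    Continuous (hGradNorm w) := by
  have h : ∀ v : Heis n, Continuous fun ξ => fderiv ℝ w ξ v := fun v =>
    (hw.continuous_fderiv one_ne_zero).clm_apply continuous_const
  have h1 := fun i : Fin n => h (Pi.single i 1, 0, 0)
  have h2 := fun i : Fin n => h (0, Pi.single i 1, 0)
  have h3 := h (0, 0, 1)
  unfold hGradNorm Xd Yd
  fun_prop

/-- Horizontal spiral from the origin through `ξ`. -/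
def hSpiral {n : ℕ} (s : ℝ) (ξ : Heis n) : Heis n :=
  hDil s (hRot (ξ.2.2 / hZ ξ * log s) ξ)

theorem hZ_hSpiral (s : ℝ) (ξ : Heis n) : hZ (hSpiral s ξ) = s ^ 2 * hZ ξ := by
  rw [hSpiral, hZ_hDil, hZ_hRot]

theorem hV_hSpiral {s : ℝ} (hs : 0 < s) (ξ : Heis n) : hV (hSpiral s ξ) = hV ξ / s := by
  rw [hSpiral, hV_hDil hs, hV_hRot]

@[fun_prop]
theorem measurable_hSpiral_comp {X : Type*} [MeasurableSpace X] {s : X → ℝ} {f : X → Heis n}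
    (hs : Measurable s) (hf : Measurable f) : Measurable fun x => hSpiral (s x) (f x) := by
  have : Measurable fun x => hRot ((f x).2.2 / hZ (f x) * log (s x)) (f x) := by fun_prop
  unfold hSpiral hDil
  fun_prop

theorem lintegral_hSpiral {s : ℝ} (hs : 0 < s) {F : Heis n → ℝ≥0∞} (hF : Measurable F) :
    ∫⁻ ξ, F (hSpiral s ξ) = ENNReal.ofReal ((s ^ (2 * n + 2))⁻¹) * ∫⁻ ξ, F ξ := by
  have h := lintegral_hRot_twist (n := n) (θ := fun ξ => ξ.2.2 / hZ ξ * log s) (by fun_prop)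
    (fun ψ ξ => by rw [hZ_hRot]; rfl) (F := fun ξ => F (hDil s ξ)) (hF.comp (measurable_hDil s))
  rw [← lintegral_hDil hs hF, ← h]
  rfl

theorem contDiffOn_hSpiral (ξ : Heis n) :
    ContDiffOn ℝ 1 (fun s => hSpiral s ξ) (Set.Ioi 0) := by
  have hlog : ContDiffOn ℝ 1 Real.log (Set.Ioi 0) :=
    Real.contDiffOn_log.mono fun x hx => ne_of_gt hx
  have hang : ContDiffOn ℝ 1 (fun s => ξ.2.2 / hZ ξ * Real.log s) (Set.Ioi 0) :=
    contDiffOn_const.mul hlog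
  unfold hSpiral hDil hRot
  refine ContDiffOn.prodMk ?_ (ContDiffOn.prodMk ?_ ?_)
  · exact contDiffOn_id.smul ((hang.cos.smul contDiffOn_const).add
      (hang.sin.smul contDiffOn_const))
  · exact contDiffOn_id.smul ((hang.sin.neg.smul contDiffOn_const).add
      (hang.cos.smul contDiffOn_const))
  · exact (contDiffOn_id.pow 2).mul contDiffOn_const

theorem hasDerivAt_hSpiral {ξ : Heis n} (hξ : 0 < hZ ξ) {s : ℝ} (hs : 0 < s) :
    HasDerivAt (fun s => hSpiral s ξ)
      (let a := s⁻¹ • ((hSpiral s ξ).1 + (ξ.2.2 / hZ ξ) • (hSpiral s ξ).2.1)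
       let b := s⁻¹ • ((hSpiral s ξ).2.1 - (ξ.2.2 / hZ ξ) • (hSpiral s ξ).1)
       (a, b, 2 * ∑ i, ((hSpiral s ξ).2.1 i * a i - (hSpiral s ξ).1 i * b i))) s := by
  have hang : HasDerivAt (fun s => ξ.2.2 / hZ ξ * Real.log s) (ξ.2.2 / hZ ξ * s⁻¹) s :=
    (Real.hasDerivAt_log hs.ne').const_mul _
  have h3 : 2 * ∑ i, ((hSpiral s ξ).2.1 i *
      (s⁻¹ • ((hSpiral s ξ).1 + (ξ.2.2 / hZ ξ) • (hSpiral s ξ).2.1)) i - (hSpiral s ξ).1 i *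
      (s⁻¹ • ((hSpiral s ξ).2.1 - (ξ.2.2 / hZ ξ) • (hSpiral s ξ).1)) i) =
      2 * s * ξ.2.2 := by
    have : ∑ i, ((hSpiral s ξ).2.1 i *
      (s⁻¹ • ((hSpiral s ξ).1 + (ξ.2.2 / hZ ξ) • (hSpiral s ξ).2.1)) i - (hSpiral s ξ).1 i *
      (s⁻¹ • ((hSpiral s ξ).2.1 - (ξ.2.2 / hZ ξ) • (hSpiral s ξ).1)) i) =
      s⁻¹ * (ξ.2.2 / hZ ξ) * hZ (hSpiral s ξ) := by
      rw [hZ.eq_1 (hSpiral s ξ), Finset.mul_sum]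
      refine Finset.sum_congr rfl fun i _ => ?_
      simp only [Pi.smul_apply, Pi.add_apply, Pi.sub_apply, smul_eq_mul]
      ring
    rw [this, hZ_hSpiral]
    field_simp
  simp only [h3]
  have hid := hasDerivAt_id s
  refine HasDerivAt.prodMk ?_ (HasDerivAt.prodMk ?_ ?_)
  · refine (hid.smul ((hang.cos.smul_const ξ.1).add (hang.sin.smul_const ξ.2.1))).congr_deriv ?_
    ext i
    simp [hSpiral, hDil, hRot]
    field_simp
    ring
  · refine (hid.smul ((hang.sin.neg.smul_const ξ.1).add
      (hang.cos.smul_const ξ.2.1))).congr_deriv ?_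
    ext i
    simp [hSpiral, hDil, hRot]
    field_simp
    ring
  · refine ((hid.pow 2).mul_const ξ.2.2).congr_deriv ?_
    simp

theorem abs_deriv_comp_hSpiral_le {w : Heis n → ℝ} (hw : ContDiff ℝ 1 w) {ξ : Heis n}
    (hξ : 0 < hZ ξ) {s : ℝ} (hs : 0 < s) :
    |deriv (fun s => w (hSpiral s ξ)) s| ≤ hGradNorm w (hSpiral s ξ) / hV ξ := by
  have h1 := ((hw.differentiable one_ne_zero (hSpiral s ξ)).hasFDerivAt).comp_hasDerivAt s
    (hasDerivAt_hSpiral hξ hs)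
  have h2 : deriv (fun s => w (hSpiral s ξ)) s = _ := h1.deriv
  rw [h2]
  refine (abs_fderiv_horizontal_le w _ _ _).trans_eq ?_
  have h3 : ∑ i, ((s⁻¹ • ((hSpiral s ξ).1 + (ξ.2.2 / hZ ξ) • (hSpiral s ξ).2.1)) i ^ 2 +
      (s⁻¹ • ((hSpiral s ξ).2.1 - (ξ.2.2 / hZ ξ) • (hSpiral s ξ).1)) i ^ 2) =
      s⁻¹ ^ 2 * (1 + (ξ.2.2 / hZ ξ) ^ 2) * hZ (hSpiral s ξ) := by
    rw [hZ.eq_1 (hSpiral s ξ), Finset.mul_sum]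
    refine Finset.sum_congr rfl fun i _ => ?_
    simp only [Pi.smul_apply, Pi.add_apply, Pi.sub_apply, smul_eq_mul]
    ring
  rw [h3, hZ_hSpiral, hV, div_eq_mul_inv (hGradNorm _ _), ← Real.sqrt_inv, mul_comm]
  congr 2
  field_simp

theorem sq_mul_hZ_le_norm_hSpiral (ξ : Heis n) (s : ℝ) :
    s ^ 2 * hZ ξ ≤ 2 * n * ‖hSpiral s ξ‖ ^ 2 := by
  rw [← hZ_hSpiral, hZ]
  have h1 : ∀ i, (hSpiral s ξ).1 i ^ 2 + (hSpiral s ξ).2.1 i ^ 2 ≤ 2 * ‖hSpiral s ξ‖ ^ 2 := by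
    intro i
    have h2 : |(hSpiral s ξ).1 i| ≤ ‖hSpiral s ξ‖ :=
      (norm_le_pi_norm (hSpiral s ξ).1 i).trans (norm_fst_le _)
    have h3 : |(hSpiral s ξ).2.1 i| ≤ ‖hSpiral s ξ‖ :=
      (norm_le_pi_norm (hSpiral s ξ).2.1 i).trans ((norm_fst_le _).trans (norm_snd_le _))
    have h4 := sq_le_sq' (by linarith [abs_nonneg ((hSpiral s ξ).1 i)]) h2
    have h5 := sq_le_sq' (by linarith [abs_nonneg ((hSpiral s ξ).2.1 i)]) h3
    rw [sq_abs] at h4 h5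
    linarith
  calc _ ≤ ∑ _i : Fin n, 2 * ‖hSpiral s ξ‖ ^ 2 := Finset.sum_le_sum fun i _ => h1 i
    _ = _ := by simp; ring

theorem tendsto_hSpiral_zero (ξ : Heis n) :
    Filter.Tendsto (fun s => hSpiral s ξ) (nhdsWithin 0 (Set.Ioi 0)) (nhds 0) := by
  have hid : Filter.Tendsto (fun s : ℝ => s) (nhdsWithin 0 (Set.Ioi 0)) (nhds 0) :=
    Filter.tendsto_id.mono_left nhdsWithin_le_nhds
  have hsm : ∀ (g : ℝ → ℝ) (x y : ℝ), (∀ s, |g s| ≤ |x| + |y|) →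
      Filter.Tendsto (fun s : ℝ => s * g s) (nhdsWithin 0 (Set.Ioi 0)) (nhds 0) := by
    intro g x y hg
    refine hid.zero_mul_isBoundedUnder_le ?_
    exact Filter.isBoundedUnder_of ⟨|x| + |y|, fun s => by simpa using hg s⟩
  have hb : ∀ u v x y : ℝ, |u| ≤ 1 → |v| ≤ 1 → |u * x + v * y| ≤ |x| + |y| := by
    intro u v x y hu hv
    refine (abs_add_le _ _).trans (add_le_add ?_ ?_) <;> rw [abs_mul]
    · exact mul_le_of_le_one_left (abs_nonneg _) hu
    · exact mul_le_of_le_one_left (abs_nonneg _) hv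
  refine Filter.Tendsto.prodMk_nhds ?_ (Filter.Tendsto.prodMk_nhds ?_ ?_)
  · refine tendsto_pi_nhds.2 fun i => hsm _ (ξ.1 i) (ξ.2.1 i) fun s => ?_
    exact hb _ _ _ _ (abs_cos_le_one _) (abs_sin_le_one _)
  · refine tendsto_pi_nhds.2 fun i => hsm _ (ξ.1 i) (ξ.2.1 i) fun s => ?_
    exact hb _ _ _ _ (by rw [abs_neg]; exact abs_sin_le_one _) (abs_cos_le_one _)
  · simpa [hRot] using (hid.pow 2).mul_const ξ.2.2

theorem abs_apply_zero_le_lintegral_hSpiral {w : Heis n → ℝ} (hw : ContDiff ℝ 1 w)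
    (hc : HasCompactSupport w) {ξ : Heis n} (hξ : 0 < hZ ξ) :
    ENNReal.ofReal |w 0| ≤
      ∫⁻ s in Set.Ioi (0 : ℝ), ENNReal.ofReal (hGradNorm w (hSpiral s ξ) / hV ξ) := by
  obtain ⟨R, hR⟩ := hc.isCompact.isBounded.exists_norm_le
  obtain ⟨b, hb0, hb⟩ : ∃ b : ℝ, 0 < b ∧ 2 * n * R ^ 2 < b ^ 2 * hZ ξ := by
    refine ⟨√(2 * n * R ^ 2 / hZ ξ + 1), by positivity, ?_⟩
    rw [Real.sq_sqrt (by positivity), add_mul, div_mul_cancel₀ _ hξ.ne']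
    linarith
  have hwb : w (hSpiral b ξ) = 0 := by
    by_contra hne
    have h1 := hR _ (subset_tsupport _ hne)
    have h2 := sq_mul_hZ_le_norm_hSpiral ξ b
    have h3 : 2 * n * ‖hSpiral b ξ‖ ^ 2 ≤ 2 * n * R ^ 2 := by gcongr
    linarith
  have hab : ∀ a ∈ Set.Ioo 0 b, ENNReal.ofReal |w (hSpiral a ξ)| ≤
      ∫⁻ s in Set.Ioi (0 : ℝ), ENNReal.ofReal (hGradNorm w (hSpiral s ξ) / hV ξ) := by
    intro a ha
    have hsub : Set.Icc a b ⊆ Set.Ioi 0 := fun s hs => ha.1.trans_le hs.1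
    have h1 := enorm_sub_le_lintegral_deriv_of_contDiffOn_Icc
      (f := fun s => w (hSpiral s ξ)) (hw.comp_contDiffOn ((contDiffOn_hSpiral ξ).mono hsub))
      ha.2.le
    rw [hwb, zero_sub, enorm_neg, ← ofReal_norm] at h1
    refine h1.trans ((setLIntegral_mono' measurableSet_Icc fun s hs => ?_).trans
      (lintegral_mono_set hsub))
    rw [← ofReal_norm]
    exact ENNReal.ofReal_le_ofReal (abs_deriv_comp_hSpiral_le hw hξ (hsub hs))
  have hlim : Filter.Tendsto (fun a => ENNReal.ofReal |w (hSpiral a ξ)|)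
      (nhdsWithin 0 (Set.Ioi 0)) (nhds (ENNReal.ofReal |w 0|)) :=
    ENNReal.tendsto_ofReal (((hw.continuous.tendsto 0).comp (tendsto_hSpiral_zero ξ)).abs)
  refine le_of_tendsto hlim ?_
  filter_upwards [Ioo_mem_nhdsGT hb0] with a ha using hab a ha

theorem hZ_pos_of_hV_pos {ξ : Heis n} (h : 0 < hV ξ) : 0 < hZ ξ := by
  refine (hZ_nonneg ξ).lt_of_ne fun h0 => h.ne' ?_
  rw [hV, ← h0, zero_div, Real.sqrt_zero]

theorem setLIntegral_Ioi_inv_pow {v : ℝ} (hv : 0 < v) (m : ℕ) :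
    ∫⁻ s in Set.Ioi v⁻¹, ENNReal.ofReal ((s ^ (m + 2))⁻¹) =
      ENNReal.ofReal (v ^ (m + 1) / (m + 1)) := by
  have hlt : (-(m + 2 : ℝ)) < -1 := by
    have : (0 : ℝ) ≤ m := by positivity
    linarith
  have hv' : 0 < v⁻¹ := by positivity
  have e : ∀ s ∈ Set.Ioi v⁻¹, ENNReal.ofReal ((s ^ (m + 2))⁻¹) =
      ENNReal.ofReal (s ^ (-(m + 2 : ℝ))) := by
    intro s hs
    have hs0 : 0 < s := hv'.trans hs
    rw [Real.rpow_neg hs0.le]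
    norm_cast
  rw [setLIntegral_congr_fun measurableSet_Ioi e, ← ofReal_integral_eq_lintegral_ofReal
    (integrableOn_Ioi_rpow_of_lt hlt hv') ?_, integral_Ioi_rpow_of_lt hlt hv']
  · congr 1
    rw [show -(m + 2 : ℝ) + 1 = -((m + 1 : ℕ) : ℝ) by push_cast; ring, Real.rpow_neg hv'.le,
      Real.rpow_natCast, inv_pow, inv_inv, neg_div_neg_eq]
    push_cast
    rfl
  · refine (ae_restrict_mem measurableSet_Ioi).mono fun s hs => ?_
    exact Real.rpow_nonneg (hv'.trans hs).le _

theorem volume_mul_abs_apply_zero_le {w : Heis n → ℝ} (hw : ContDiff ℝ 1 w)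
    (hc : HasCompactSupport w) :
    ENNReal.ofReal ((2 * n + 2) * |w 0|) * volume {ξ : Heis n | 1 < hV ξ} ≤
      ∫⁻ η, ENNReal.ofReal (hGradNorm w η) * ENNReal.ofReal (hV η ^ (2 * n + 1)) := by
  have hf : Measurable (hGradNorm w) := (continuous_hGradNorm hw).measurable
  have hf0 : ∀ η, 0 ≤ hGradNorm w η := fun η => Real.sqrt_nonneg _
  set K : ℝ → Heis n → ℝ≥0∞ := fun s η =>
    {z : ℝ × Heis n | 1 < z.1 * hV z.2}.indicator
      (fun z => ENNReal.ofReal (hGradNorm w z.2 / (z.1 * hV z.2))) (s, η) with hK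
  have hKm : Measurable (Function.uncurry K) := by
    have : Measurable fun z : ℝ × Heis n =>
        ENNReal.ofReal (hGradNorm w z.2 / (z.1 * hV z.2)) := by fun_prop
    exact this.indicator (measurableSet_lt measurable_const (by fun_prop))
  have hKs : ∀ s, Measurable (K s) := fun s => hKm.comp measurable_prodMk_left
  have hU : MeasurableSet {ξ : Heis n | 1 < hV ξ} :=
    measurableSet_lt measurable_const measurable_hV
  have hQ : (0 : ℝ) < 2 * n + 2 := by positivity
  have h1 : ENNReal.ofReal |w 0| * volume {ξ : Heis n | 1 < hV ξ} ≤
      ∫⁻ ξ, ∫⁻ s in Set.Ioi (0 : ℝ), K s (hSpiral s ξ) := by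
    rw [← setLIntegral_const]
    refine (setLIntegral_mono' hU fun ξ hξ => ?_).trans (setLIntegral_le_lintegral _ _)
    have hv : 1 < hV ξ := hξ
    refine (abs_apply_zero_le_lintegral_hSpiral hw hc
      (hZ_pos_of_hV_pos (zero_lt_one.trans hv))).trans
      (setLIntegral_mono' measurableSet_Ioi fun s hs => ?_)
    have hs0 : (0 : ℝ) < s := hs
    have e : s * hV (hSpiral s ξ) = hV ξ := by
      rw [hV_hSpiral hs0]; field_simp
    simp only [hK, Set.indicator_apply, Set.mem_ofPred_eq, e, hv, if_true]
    exact le_rfl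
  have h2 : ∫⁻ ξ, ∫⁻ s in Set.Ioi (0 : ℝ), K s (hSpiral s ξ) =
      ∫⁻ s in Set.Ioi (0 : ℝ), ENNReal.ofReal ((s ^ (2 * n + 2))⁻¹) * ∫⁻ ξ : Heis n, K s ξ := by
    rw [lintegral_lintegral_swap]
    · exact setLIntegral_congr_fun measurableSet_Ioi fun s hs => lintegral_hSpiral hs (hKs s)
    · have : Measurable fun z : Heis n × ℝ => Function.uncurry K (z.2, hSpiral z.2 z.1) :=
        hKm.comp (by fun_prop)
      exact this.aemeasurable
  have h3 : ∫⁻ s in Set.Ioi (0 : ℝ), ENNReal.ofReal ((s ^ (2 * n + 2))⁻¹) *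
      ∫⁻ ξ : Heis n, K s ξ = ∫⁻ η : Heis n, ∫⁻ s in Set.Ioi (0 : ℝ),
        ENNReal.ofReal ((s ^ (2 * n + 2))⁻¹) * K s η := by
    rw [lintegral_lintegral_swap]
    · exact lintegral_congr fun s => (lintegral_const_mul _ (hKs s)).symm
    · have : Measurable fun z : Heis n × ℝ => ENNReal.ofReal ((z.2 ^ (2 * n + 2))⁻¹) *
          Function.uncurry K (z.2, z.1) :=
        Measurable.mul (by fun_prop) (hKm.comp (by fun_prop))
      exact this.aemeasurable
  have h4 : ∀ η : Heis n, ∫⁻ s in Set.Ioi (0 : ℝ), ENNReal.ofReal ((s ^ (2 * n + 2))⁻¹) * K s η ≤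
      ENNReal.ofReal (2 * n + 2)⁻¹ *
        (ENNReal.ofReal (hGradNorm w η) * ENNReal.ofReal (hV η ^ (2 * n + 1))) := by
    intro η
    rcases (hV_nonneg η).eq_or_lt with h0 | hv
    · have : ∀ s, K s η = 0 := by
        intro s; simp [hK, Set.indicator_apply, ← h0]
      simp [this]
    · have e : ∀ s ∈ Set.Ioi (0 : ℝ), ENNReal.ofReal ((s ^ (2 * n + 2))⁻¹) * K s η =
          (Set.Ioi (hV η)⁻¹).indicator (fun s => ENNReal.ofReal (hGradNorm w η / hV η) *
            ENNReal.ofReal ((s ^ (2 * n + 1 + 2))⁻¹)) s := by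
        intro s hs
        have hs0 : (0 : ℝ) < s := hs
        have hiff : 1 < s * hV η ↔ (hV η)⁻¹ < s := by rw [inv_lt_iff_one_lt_mul₀ hv, mul_comm]
        simp only [hK, Set.indicator_apply, Set.mem_ofPred_eq, Set.mem_Ioi, hiff]
        split_ifs with h
        · rw [← ENNReal.ofReal_mul (by positivity), ← ENNReal.ofReal_mul
            (div_nonneg (hf0 η) hv.le)]
          congr 1
          field_simp
          ring
        · simp
      rw [setLIntegral_congr_fun measurableSet_Ioi e, lintegral_indicator measurableSet_Ioi,
        Measure.restrict_restrict measurableSet_Ioi,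
        Set.inter_eq_left.2 (Set.Ioi_subset_Ioi (by positivity)), lintegral_const_mul _ (by fun_prop),
        setLIntegral_Ioi_inv_pow hv, ← ENNReal.ofReal_mul (div_nonneg (hf0 η) hv.le),
        ← ENNReal.ofReal_mul (hf0 η), ← ENNReal.ofReal_mul (by positivity)]
      refine ENNReal.ofReal_le_ofReal (le_of_eq ?_)
      push_cast
      field_simp
      ring
  have h5 : ENNReal.ofReal |w 0| * volume {ξ : Heis n | 1 < hV ξ} ≤
      ENNReal.ofReal (2 * n + 2)⁻¹ *
        ∫⁻ η, ENNReal.ofReal (hGradNorm w η) * ENNReal.ofReal (hV η ^ (2 * n + 1)) := by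
    refine h1.trans ((h2.trans h3).trans_le ((lintegral_mono h4).trans_eq ?_))
    exact lintegral_const_mul _ (by fun_prop)
  rw [ENNReal.ofReal_mul hQ.le, mul_assoc]
  refine (mul_le_mul_right h5 _).trans_eq ?_
  rw [← mul_assoc, ← ENNReal.ofReal_mul hQ.le, mul_inv_cancel₀ hQ.ne', ENNReal.ofReal_one, one_mul]

/-- Left translations as homeomorphisms. -/
def hMulHomeo (a : Heis n) : Heis n ≃ₜ Heis n where
  toFun := hMul a
  invFun := hMul (-a)
  left_inv := hMul_neg_hMul a
  right_inv := hMul_hMul_neg a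
  continuous_toFun := by fun_prop
  continuous_invFun := by fun_prop

theorem hMul_zero (a : Heis n) : hMul a 0 = a := by
  simp [hMul]

theorem contDiff_hMul (a : Heis n) : ContDiff ℝ 1 (hMul a : Heis n → Heis n) := by
  unfold hMul; fun_prop

theorem fderiv_hMul_apply (a ξ v : Heis n) :
    fderiv ℝ (hMul a) ξ v =
      (v.1, v.2.1, v.2.2 + 2 * ((∑ i, a.2.1 i * v.1 i) - ∑ i, a.1 i * v.2.1 i)) := by
  have h : HasDerivAt (fun s : ℝ => hMul a (ξ + s • v))
      (v.1, v.2.1, v.2.2 + 2 * ((∑ i, a.2.1 i * v.1 i) - ∑ i, a.1 i * v.2.1 i)) 0 := by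
    have e : (fun s : ℝ => hMul a (ξ + s • v)) = fun s : ℝ => hMul a ξ + s •
        ((v.1, v.2.1, v.2.2 + 2 * ((∑ i, a.2.1 i * v.1 i) - ∑ i, a.1 i * v.2.1 i)) : Heis n) := by
      ext1 s
      refine Prod.ext ?_ (Prod.ext ?_ ?_)
      · simp [hMul, add_assoc]
      · simp [hMul, add_assoc]
      · simp only [hMul, Prod.fst_add, Prod.snd_add, Prod.smul_fst, Prod.smul_snd, Pi.add_apply,
          Pi.smul_apply, smul_eq_mul, mul_add, Finset.sum_add_distrib, mul_left_comm _ s,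
          ← Finset.mul_sum]
        ring
    rw [e]
    simpa using ((hasDerivAt_id (0 : ℝ)).smul_const
      ((v.1, v.2.1, v.2.2 + 2 * ((∑ i, a.2.1 i * v.1 i) - ∑ i, a.1 i * v.2.1 i)) : Heis n)).const_add
      (hMul a ξ)
  have h0 : HasFDerivAt (hMul a) (fderiv ℝ (hMul a) ξ) (ξ + (0 : ℝ) • v) := by
    simpa using ((contDiff_hMul a).differentiable one_ne_zero ξ).hasFDerivAt
  have hl : HasDerivAt (fun s : ℝ => ξ + s • v) v 0 := by
    simpa using ((hasDerivAt_id (0 : ℝ)).smul_const v).const_add ξ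
  have h1 : HasDerivAt (fun s : ℝ => hMul a (ξ + s • v)) (fderiv ℝ (hMul a) ξ v) 0 :=
    HasFDerivAt.comp_hasDerivAt (f := fun s : ℝ => ξ + s • v) (0 : ℝ) h0 hl
  exact h1.unique h

theorem hGradNorm_comp_hMul {w : Heis n → ℝ} (hw : ContDiff ℝ 1 w) (a ξ : Heis n) :
    hGradNorm (fun η => w (hMul a η)) ξ = hGradNorm w (hMul a ξ) := by
  have hfd : ∀ v, fderiv ℝ (fun η => w (hMul a η)) ξ v = fderiv ℝ w (hMul a ξ)
      (v.1, v.2.1, v.2.2 + 2 * ((∑ i, a.2.1 i * v.1 i) - ∑ i, a.1 i * v.2.1 i)) := by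
    intro v
    have := fderiv_comp ξ (hw.differentiable one_ne_zero (hMul a ξ))
      ((contDiff_hMul a).differentiable one_ne_zero ξ)
    change fderiv ℝ (w ∘ hMul a) ξ v = _
    rw [this, ContinuousLinearMap.comp_apply, fderiv_hMul_apply]
  have hT : fderiv ℝ (fun η => w (hMul a η)) ξ (0, 0, 1) = fderiv ℝ w (hMul a ξ) (0, 0, 1) := by
    rw [hfd]; simp
  have hX : ∀ i, Xd (fun η => w (hMul a η)) i ξ = Xd w i (hMul a ξ) := by
    intro i
    have e : fderiv ℝ (fun η => w (hMul a η)) ξ (Pi.single i 1, 0, 0) =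
        fderiv ℝ w (hMul a ξ) ((Pi.single i 1, 0, 0) + (2 * a.2.1 i) • ((0, 0, 1) : Heis n)) := by
      rw [hfd]
      congr 1
      refine Prod.ext ?_ (Prod.ext ?_ ?_) <;> simp [Pi.single_apply]
    rw [Xd, Xd, hT, e, map_add, map_smul]
    simp only [smul_eq_mul, hMul, Pi.add_apply]
    ring
  have hY : ∀ i, Yd (fun η => w (hMul a η)) i ξ = Yd w i (hMul a ξ) := by
    intro i
    have e : fderiv ℝ (fun η => w (hMul a η)) ξ (0, Pi.single i 1, 0) =
        fderiv ℝ w (hMul a ξ) ((0, Pi.single i 1, 0) + (-(2 * a.1 i)) • ((0, 0, 1) : Heis n)) := by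
      rw [hfd]
      congr 1
      refine Prod.ext ?_ (Prod.ext ?_ ?_) <;> simp [Pi.single_apply]
    rw [Yd, Yd, hT, e, map_add, map_smul]
    simp only [smul_eq_mul, hMul, Pi.add_apply]
    ring
  simp only [hGradNorm, hX, hY]

/-- The kernel representing functions by their horizontal gradients. -/
def hKer {n : ℕ} (ξ η : Heis n) : ℝ≥0∞ := ENNReal.ofReal (hV (hMul (-ξ) η) ^ (2 * n + 1))

theorem measurable_hKer : Measurable (Function.uncurry (hKer : Heis n → Heis n → ℝ≥0∞)) := by
  have h : Measurable fun z : Heis n × Heis n => hMul (-z.1) z.2 :=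
    (continuous_hMul_comp continuous_fst.neg continuous_snd).measurable
  have : Measurable fun z : Heis n × Heis n => hV (hMul (-z.1) z.2) := measurable_hV.comp h
  unfold Function.uncurry hKer
  fun_prop

theorem hKer_symm (ξ η : Heis n) : hKer ξ η = hKer η ξ := by
  have : hMul (-ξ) η = -hMul (-η) ξ := by
    unfold hMul
    refine Prod.ext ?_ (Prod.ext ?_ ?_)
    · simp
    · simp
    · simp only [Prod.fst_neg, Prod.snd_neg, Pi.neg_apply, neg_mul, Finset.sum_neg_distrib]
      rw [Finset.sum_congr rfl fun i _ => mul_comm (ξ.2.1 i) (η.1 i),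
        Finset.sum_congr rfl fun i _ => mul_comm (ξ.1 i) (η.2.1 i)]
      ring
  rw [hKer, hKer, this, hV_neg]

theorem sigmaQ_mul_abs_le_lintegral (hn : 1 ≤ n) {w : Heis n → ℝ} (hw : ContDiff ℝ 1 w)
    (hc : HasCompactSupport w) (ξ : Heis n) :
    ENNReal.ofReal (sigmaQ n * |w ξ|) ≤ ∫⁻ η, ENNReal.ofReal (hGradNorm w η) * hKer ξ η := by
  have hw' : ContDiff ℝ 1 (fun η => w (hMul ξ η)) := hw.comp (contDiff_hMul ξ)
  have hc' : HasCompactSupport (fun η => w (hMul ξ η)) := hc.comp_homeomorph (hMulHomeo ξ)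
  have h := volume_mul_abs_apply_zero_le hw' hc'
  have h0 : (0 : ℝ) ≤ (2 * n + 2) * |w ξ| := by positivity
  rw [volume_one_lt_hV hn, hMul_zero, ← ENNReal.ofReal_mul h0] at h
  have hf : Measurable (hGradNorm w) := (continuous_hGradNorm hw).measurable
  have hk : Measurable (hKer ξ) := measurable_hKer.of_uncurry_left
  have hm : Measurable fun η => ENNReal.ofReal (hGradNorm w η) * hKer ξ η :=
    hf.ennreal_ofReal.mul hk
  have e : ∫⁻ η, ENNReal.ofReal (hGradNorm (fun η => w (hMul ξ η)) η) *
      ENNReal.ofReal (hV η ^ (2 * n + 1)) =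
      ∫⁻ η, ENNReal.ofReal (hGradNorm w η) * hKer ξ η := by
    rw [← (measurePreserving_hMul ξ).lintegral_comp hm]
    refine lintegral_congr fun η => ?_
    rw [hGradNorm_comp_hMul hw, hKer, hMul_neg_hMul]
  rw [e] at h
  refine le_of_eq_of_le ?_ h
  congr 1
  field_simp

theorem sigmaQ_pos (n : ℕ) : 0 < sigmaQ n := by
  have h1 : 0 < Gamma (1 / 2 : ℝ) := Real.Gamma_pos_of_pos (by norm_num)
  have h2 : 0 < Gamma ((n : ℝ) + 1 / 2) := Real.Gamma_pos_of_pos (by positivity)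
  unfold sigmaQ omegaSphere
  positivity

/-- The sharp weak-type constant of `hKer`. -/
def hKerConst (n : ℕ) : ℝ :=
  (2 * n + 2) * (sigmaQ n / (2 * n + 2)) ^ ((2 * n + 1 : ℝ) / (2 * n + 2))

theorem hKerConst_pos (n : ℕ) : 0 < hKerConst n := by
  have := sigmaQ_pos n
  unfold hKerConst; positivity

theorem setLIntegral_hKer_le (hn : 1 ≤ n) (ξ : Heis n) (D : Set (Heis n)) :
    ∫⁻ η in D, hKer ξ η ≤
      ENNReal.ofReal (hKerConst n) * volume D ^ (1 / (2 * n + 2 : ℝ)) := by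
  have hm : Measurable fun η : Heis n => hMul (-ξ) η :=
    (continuous_hMul_comp continuous_const continuous_id).measurable
  have hσ := sigmaQ_pos n
  have hp : 1 < (2 * n + 2 : ℝ) / (2 * n + 1) := by
    rw [one_lt_div (by positivity)]; linarith
  have h := setLIntegral_le_of_distribution_le (μ := (volume : Measure (Heis n)))
    (k := fun η => hV (hMul (-ξ) η) ^ (2 * n + 1)) (by fun_prop)
    (fun η => by have := hV_nonneg (hMul (-ξ) η); positivity) (a := sigmaQ n / (2 * n + 2))
    (by positivity) hp (fun t ht => ?_) D
  · refine h.trans_eq ?_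
    have e1 : 1 / ((2 * n + 2 : ℝ) / (2 * n + 1)) = (2 * n + 1 : ℝ) / (2 * n + 2) := by
      rw [one_div_div]
    have e2 : (2 * n + 2 : ℝ) / (2 * n + 1) / ((2 * n + 2 : ℝ) / (2 * n + 1) - 1) = 2 * n + 2 := by
      have : (2 * n + 1 : ℝ) ≠ 0 := by positivity
      rw [div_sub_one this, show (2 * n + 2 : ℝ) - (2 * n + 1) = 1 by ring]
      field_simp
    have e3 : 1 - (2 * n + 1 : ℝ) / (2 * n + 2) = 1 / (2 * n + 2) := by
      have : (2 * n + 2 : ℝ) ≠ 0 := by positivity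
      rw [one_sub_div this, show (2 * n + 2 : ℝ) - (2 * n + 1) = 1 by ring]
    rw [e1, e2, e3, hKerConst]
  · set u : ℝ := t ^ (1 / (2 * n + 1 : ℝ)) with hu
    have hu0 : 0 < u := Real.rpow_pos_of_pos ht _
    have hut : u ^ (2 * n + 1) = t := by
      rw [hu, ← Real.rpow_natCast, ← Real.rpow_mul ht.le]
      push_cast
      rw [one_div_mul_cancel (by positivity), Real.rpow_one]
    have hset : {η : Heis n | t < hV (hMul (-ξ) η) ^ (2 * n + 1)} =
        hMul (-ξ) ⁻¹' {η | u < hV η} := by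
      ext η
      simp only [Set.mem_ofPred_eq, Set.mem_preimage]
      rw [← hut, pow_lt_pow_iff_left₀ hu0.le (hV_nonneg _) (by omega)]
    rw [hset, (measurePreserving_hMul (-ξ)).measure_preimage
      (measurableSet_lt measurable_const measurable_hV).nullMeasurableSet, volume_lt_hV hu0,
      volume_one_lt_hV hn, ← ENNReal.ofReal_mul (by positivity)]
    refine ENNReal.ofReal_le_ofReal (le_of_eq ?_)
    rw [mul_comm]
    congr 1
    rw [hu, ← Real.rpow_natCast, ← Real.rpow_mul ht.le, ← Real.rpow_neg ht.le]
    congr 1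
    push_cast
    field_simp

theorem alphaQ_eq (n : ℕ) :
    alphaQ n = ((2 * n + 2) * sigmaQ n / hKerConst n) ^ ((2 * (n : ℝ) + 2) / (2 * n + 1)) := by
  have hσ := sigmaQ_pos n
  set Q : ℝ := 2 * n + 2 with hQ
  have hQ0 : 0 < Q := by positivity
  have h1 : (2 * n + 1 : ℝ) = Q - 1 := by rw [hQ]; ring
  have h2 : 0 < Q - 1 := by rw [← h1]; positivity
  set A : ℝ := sigmaQ n / Q with hA
  have hA0 : 0 < A := by positivity
  have hs : sigmaQ n = Q * A := by rw [hA]; field_simp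
  rw [alphaQ, hKerConst, ← hQ, h1, ← hA, hs]
  have e1 : Q * (Q * A) / (Q * A ^ ((Q - 1) / Q)) = Q * A ^ (1 / Q) := by
    have : A = A ^ ((Q - 1) / Q) * A ^ (1 / Q) := by
      rw [← Real.rpow_add hA0, ← add_div, sub_add_cancel, div_self hQ0.ne', Real.rpow_one]
    have h3 : 0 < A ^ ((Q - 1) / Q) := Real.rpow_pos_of_pos hA0 _
    rw [mul_div_mul_left _ _ hQ0.ne', div_eq_iff h3.ne']
    nth_rw 1 [this]
    ring
  rw [e1, Real.mul_rpow hQ0.le (Real.rpow_nonneg hA0.le _), ← Real.rpow_mul hA0.le,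
    Real.mul_rpow hQ0.le hA0.le, ← mul_assoc]
  congr 1
  · nth_rw 1 [← Real.rpow_one Q]
    rw [← Real.rpow_add hQ0]
    congr 1
    field_simp
    ring
  · congr 1
    field_simp

theorem hasSum_zeta (m : ℕ) (s : ℝ) :
    HasSum (fun k : ℕ => s ^ (k + m) / ((k + m).factorial : ℝ)) (zeta (m + 1) s) := by
  have h : HasSum (fun k : ℕ => s ^ k / (k.factorial : ℝ)) (Real.exp s) := by
    rw [Real.exp_eq_exp_ℝ]
    exact NormedSpace.expSeries_div_hasSum_exp s
  rw [zeta, Nat.add_sub_cancel]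
  exact (hasSum_nat_add_iff' m).2 h

theorem zeta_mul_le {c s : ℝ} (hc0 : 0 ≤ c) (hc1 : c ≤ 1) (hs : 0 ≤ s) (m : ℕ) :
    zeta (m + 1) (c * s) ≤ c ^ m * zeta (m + 1) s := by
  refine hasSum_le (fun k => ?_) (hasSum_zeta m (c * s)) ((hasSum_zeta m s).mul_left (c ^ m))
  rw [mul_pow, ← mul_div_assoc]
  refine div_le_div_of_nonneg_right (mul_le_mul_of_nonneg_right ?_ (by positivity)) (by positivity)
  exact pow_le_pow_of_le_one hc0 hc1 (Nat.le_add_left m k)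

theorem zeta_le_exp {s : ℝ} (hs : 0 ≤ s) (Q : ℕ) : zeta Q s ≤ Real.exp s :=
  sub_le_self _ (Finset.sum_nonneg fun k _ => by positivity)

theorem hNorm_nonneg (ξ : Heis n) : 0 ≤ hNorm ξ := Real.rpow_nonneg (by positivity) _

theorem hNorm_eq (ξ : Heis n) : hNorm ξ = (hZ ξ ^ 2 + ξ.2.2 ^ 2) ^ ((1 : ℝ) / 4) := rfl

theorem continuous_hNorm : Continuous (hNorm : Heis n → ℝ) := by
  have h : Continuous fun ξ : Heis n => hZ ξ ^ 2 + ξ.2.2 ^ 2 := by fun_prop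
  exact h.rpow_const fun _ => Or.inr (by norm_num)

@[fun_prop]
theorem measurable_hNorm : Measurable (hNorm : Heis n → ℝ) := continuous_hNorm.measurable

theorem hNorm_hDil {s : ℝ} (hs : 0 ≤ s) (ξ : Heis n) : hNorm (hDil s ξ) = s * hNorm ξ := by
  rw [hNorm_eq, hNorm_eq, hZ_hDil]
  have : (s ^ 2 * hZ ξ) ^ 2 + (hDil s ξ).2.2 ^ 2 = s ^ 4 * (hZ ξ ^ 2 + ξ.2.2 ^ 2) := by
    have : (hDil s ξ).2.2 = s ^ 2 * ξ.2.2 := rfl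
    rw [this]; ring
  rw [this, Real.mul_rpow (by positivity) (by positivity), ← Real.rpow_natCast, ← Real.rpow_mul hs]
  norm_num

theorem volume_hNorm_lt {s : ℝ} (hs : 0 < s) :
    volume {ξ : Heis n | hNorm ξ < s} =
      ENNReal.ofReal (s ^ (2 * n + 2)) * volume {ξ : Heis n | hNorm ξ < 1} := by
  have hset : {ξ : Heis n | hNorm ξ < s} = hDil s⁻¹ ⁻¹' {ξ : Heis n | hNorm ξ < 1} := by
    ext ξ
    simp only [Set.mem_ofPred_eq, Set.mem_preimage]
    rw [hNorm_hDil (by positivity), inv_mul_lt_one₀ hs]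
  rw [hset, volume_preimage_hDil (inv_pos.2 hs) (measurableSet_lt measurable_hNorm measurable_const),
    inv_pow, inv_inv]

theorem volume_hNorm_lt_one_ne_top : volume {ξ : Heis n | hNorm ξ < 1} ≠ ∞ := by
  refine ((measure_mono fun ξ hξ => ?_).trans_lt (b := volume
    (hDil (1 / 2) ⁻¹' {ξ : Heis n | hZ ξ + ξ.2.2 ^ 2 < 1})) ?_).ne
  · have h : hNorm ξ < 1 := hξ
    rw [hNorm_eq] at h
    have h1 : hZ ξ ^ 2 + ξ.2.2 ^ 2 < 1 := by
      by_contra hge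
      exact absurd (Real.one_le_rpow (not_lt.1 hge) (by norm_num)) (not_le.2 h)
    have h2 : hZ ξ < 1 := by nlinarith [sq_nonneg ξ.2.2, hZ_nonneg ξ]
    change hZ (hDil (1 / 2) ξ) + ((1 / 2) ^ 2 * ξ.2.2) ^ 2 < 1
    rw [hZ_hDil]
    nlinarith [sq_nonneg (hZ ξ), sq_nonneg ξ.2.2]
  · rw [volume_preimage_hDil (by norm_num) isOpen_unitSet.measurableSet]
    exact ENNReal.mul_lt_top ENNReal.ofReal_lt_top volume_unitSet_lt_top

theorem exists_weight_bound {β : ℝ} (hβ0 : 0 ≤ β) (hβ : β < 2 * n + 2) :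
    ∃ H : ℝ, 0 ≤ H ∧ ∀ D : Set (Heis n), ∫⁻ ξ in D, ENNReal.ofReal (hNorm ξ ^ (-β)) ≤
      ENNReal.ofReal H * volume D ^ (1 - β / (2 * n + 2)) := by
  rcases hβ0.eq_or_lt with rfl | hβp
  · exact ⟨1, zero_le_one, fun D => by simp⟩
  set V : ℝ := (volume {ξ : Heis n | hNorm ξ < 1}).toReal with hV
  have hV' : volume {ξ : Heis n | hNorm ξ < 1} = ENNReal.ofReal V :=
    (ENNReal.ofReal_toReal volume_hNorm_lt_one_ne_top).symm
  have hVpos : 0 < V := by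
    refine ENNReal.toReal_pos (IsOpen.measure_pos volume
      (isOpen_lt continuous_hNorm continuous_const) ⟨0, ?_⟩).ne' volume_hNorm_lt_one_ne_top
    simp [hNorm]
  have hp : 1 < (2 * n + 2) / β := (one_lt_div hβp).2 hβ
  refine ⟨(2 * n + 2) / β / ((2 * n + 2) / β - 1) * V ^ (1 / ((2 * n + 2) / β)),
    mul_nonneg (div_nonneg (by positivity) (by linarith)) (by positivity), fun D => ?_⟩
  have h := setLIntegral_le_of_distribution_le (μ := (volume : Measure (Heis n)))
    (k := fun ξ => hNorm ξ ^ (-β)) (by fun_prop) (fun ξ => Real.rpow_nonneg (hNorm_nonneg ξ) _)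
    hVpos hp (fun t ht => ?_) D
  · rwa [one_div_div] at h ⊢
  · have hu : 0 < t ^ (-β⁻¹) := Real.rpow_pos_of_pos ht _
    refine (measure_mono fun ξ hξ => ?_).trans_eq
      (?_ : volume {ξ : Heis n | hNorm ξ < t ^ (-β⁻¹)} = _)
    · have hlt : t < hNorm ξ ^ (-β) := hξ
      have hpos : 0 < hNorm ξ := by
        refine (hNorm_nonneg ξ).lt_of_ne fun h0 => ?_
        rw [← h0, Real.zero_rpow (by linarith)] at hlt
        linarith
      have := Real.rpow_lt_rpow_of_neg ht hlt (z := -β⁻¹) (by simpa using hβp)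
      rwa [← Real.rpow_mul hpos.le, neg_mul_neg, mul_inv_cancel₀ hβp.ne', Real.rpow_one] at this
    · rw [volume_hNorm_lt hu, hV', ← ENNReal.ofReal_mul (by positivity), mul_comm V]
      congr 2
      rw [← Real.rpow_natCast, ← Real.rpow_mul ht.le]
      congr 1
      push_cast
      field_simp

theorem hBall_eq (ξ₀ : Heis n) (r : ℝ) :
    hBall ξ₀ r = hMul (-ξ₀) ⁻¹' {ξ | hNorm ξ < r} := rfl

theorem measurableSet_hBall (ξ₀ : Heis n) (r : ℝ) : MeasurableSet (hBall ξ₀ r) := by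
  rw [hBall_eq]
  exact (measurePreserving_hMul _).measurable (measurableSet_lt measurable_hNorm measurable_const)

theorem volume_hBall (ξ₀ : Heis n) (r : ℝ) :
    volume (hBall ξ₀ r) = volume {ξ : Heis n | hNorm ξ < r} := by
  rw [hBall_eq, (measurePreserving_hMul _).measure_preimage
    (measurableSet_lt measurable_hNorm measurable_const).nullMeasurableSet]

theorem hGradNorm_eq_zero_of_notMem_hBall {w : Heis n → ℝ} (hw : ContDiff ℝ 1 w) {ξ₀ : Heis n}
    {r : ℝ} (hr : 0 < r) (hw0 : ∀ ξ, ξ ∉ hBall ξ₀ r → w ξ = 0) {ξ : Heis n}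
    (hξ : ξ ∉ hBall ξ₀ r) : hGradNorm w ξ = 0 := by
  have hout : ∀ η, r < hNorm (hMul (-ξ₀) η) → hGradNorm w η = 0 := by
    intro η hη
    have hopen : IsOpen {η : Heis n | r < hNorm (hMul (-ξ₀) η)} :=
      isOpen_lt continuous_const (continuous_hNorm.comp (by fun_prop))
    have hev : w =ᶠ[nhds η] fun _ => 0 := by
      filter_upwards [hopen.mem_nhds hη] with ζ hζ
      refine hw0 ζ ?_
      rw [hBall_eq]
      exact not_lt.2 (le_of_lt hζ)
    have hfd : fderiv ℝ w η = 0 := by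
      rw [hev.fderiv_eq]; simp
    simp [hGradNorm, Xd, Yd, hfd]
  rw [hBall_eq] at hξ
  have hle : r ≤ hNorm (hMul (-ξ₀) ξ) := not_lt.1 hξ
  have hc : Continuous fun s : ℝ => hGradNorm w (hMul ξ₀ (hDil s (hMul (-ξ₀) ξ))) := by
    have : Continuous fun s : ℝ => hDil s (hMul (-ξ₀) ξ) := by unfold hDil; fun_prop
    exact (continuous_hGradNorm hw).comp (continuous_hMul_comp continuous_const this)
  have hlim := (hc.tendsto 1).mono_left (nhdsWithin_le_nhds (s := Set.Ioi 1))
  have h1 : hDil 1 (hMul (-ξ₀) ξ) = hMul (-ξ₀) ξ := by simp [hDil]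
  rw [h1, hMul_hMul_neg] at hlim
  refine tendsto_nhds_unique_of_eventuallyEq hlim tendsto_const_nhds ?_
  filter_upwards [self_mem_nhdsWithin] with s hs
  have hs1 : (1 : ℝ) < s := hs
  refine hout _ ?_
  rw [hMul_neg_hMul, hNorm_hDil (by linarith)]
  nlinarith

theorem exists_normalized_bound (hn : 1 ≤ n) {r : ℝ} (hr : 0 < r) {β : ℝ} (hβ0 : 0 ≤ β)
    (hβ : β < 2 * n + 2) :
    ∃ C : ℝ, 0 ≤ C ∧ ∀ (ξ₀ : Heis n) (f w : Heis n → ℝ), Measurable f → Measurable w →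
      (∀ ξ, 0 ≤ f ξ) → (∀ ξ, ξ ∉ hBall ξ₀ r → f ξ = 0) →
      (∫⁻ ξ, ENNReal.ofReal (f ξ ^ (2 * n + 2)) ≤ 1) →
      (∀ ξ, ENNReal.ofReal (sigmaQ n * |w ξ|) ≤ ∫⁻ η, ENNReal.ofReal (f η) * hKer ξ η) →
      ∫⁻ ξ in hBall ξ₀ r, ENNReal.ofReal (hNorm ξ ^ (-β)) * ENNReal.ofReal (Real.exp
        ((1 - β / (2 * n + 2)) *
          (alphaQ n * |w ξ| ^ ((2 * (n : ℝ) + 2) / (2 * n + 1))))) ≤ ENNReal.ofReal C := by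
  obtain ⟨H, hH, hHD⟩ := exists_weight_bound hβ0 hβ
  set M : ℝ := (volume {ξ : Heis n | hNorm ξ < r}).toReal + 1 with hM
  have hMpos : 0 < M := by positivity
  have hvol : ∀ ξ₀ : Heis n, volume (hBall ξ₀ r) ≤ ENNReal.ofReal M := by
    intro ξ₀
    rw [volume_hBall, ← ENNReal.ofReal_toReal (a := volume {ξ : Heis n | hNorm ξ < r}) ?_]
    · exact ENNReal.ofReal_le_ofReal (by linarith)
    · rw [volume_hNorm_lt hr]
      exact ENNReal.mul_ne_top ENNReal.ofReal_ne_top volume_hNorm_lt_one_ne_top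
  have hQ : (0 : ℝ) < 2 * n + 2 := by positivity
  have hQ1 : (0 : ℝ) < 2 * n + 1 := by positivity
  have hpq : ((2 * (n : ℝ) + 2) / (2 * n + 1)).HolderConjugate (2 * n + 2) := by
    rw [Real.holderConjugate_iff]
    refine ⟨by rw [one_lt_div hQ1]; linarith, ?_⟩
    rw [inv_div]; field_simp; ring
  have hq2 : (2 * (n : ℝ) + 2) / (2 * n + 1) ≤ 2 := by
    rw [div_le_iff₀ hQ1]
    have : (0 : ℝ) ≤ n := by positivity
    linarith
  have hγ : 0 < 1 - β / (2 * n + 2) := by rw [sub_pos, div_lt_one hQ]; exact hβ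
  obtain ⟨C, hC, hbound⟩ := exists_adams_kernel_bound (volume : Measure (Heis n)) measurable_hKer
    (hKerConst_pos n) hpq hq2 (fun ξ D _ => setLIntegral_hKer_le hn ξ D)
    (fun η E _ => by
      simp_rw [hKer_symm _ η]
      exact setLIntegral_hKer_le hn η E) hγ hMpos hH (sigmaQ_pos n)
  refine ⟨C, hC, fun ξ₀ f w hf hw hf0 hfout hfI hrep => ?_⟩
  refine le_of_eq_of_le ?_ (hbound (fun ξ => ENNReal.ofReal (hNorm ξ ^ (-β))) (by fun_prop)
    (fun D _ => hHD D) (hBall ξ₀ r) (measurableSet_hBall ξ₀ r) (hvol ξ₀) f w hf hw hf0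
    (fun a ha => (measure_mono fun ξ hξ => ?_).trans (hvol ξ₀)) (le_of_eq_of_le ?_ hfI) hrep)
  · refine lintegral_congr fun ξ => ?_
    rw [alphaQ_eq, Real.mul_rpow (by have := sigmaQ_pos n; have := hKerConst_pos n; positivity)
      (abs_nonneg _)]
  · by_contra hout
    have hlt : a < f ξ := hξ
    rw [hfout ξ hout] at hlt
    linarith
  · refine lintegral_congr fun ξ => ?_
    rw [← Real.rpow_natCast]
    push_cast
    rfl

end

theorem eq_zero_of_lintegral_hGradNorm_eq_zero {n : ℕ} (hn : 1 ≤ n) {w : Heis n → ℝ}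
    (hw : ContDiff ℝ 1 w) (hc : HasCompactSupport w)
    (h : ∫⁻ ξ, ENNReal.ofReal (hGradNorm w ξ ^ (2 * n + 2)) = 0) (ξ : Heis n) : w ξ = 0 := by
  have hf : Measurable (hGradNorm w) := (continuous_hGradNorm hw).measurable
  have hrep := sigmaQ_mul_abs_le_lintegral hn hw hc ξ
  have h0 : ∀ᵐ η, ENNReal.ofReal (hGradNorm w η) * hKer ξ η = 0 := by
    filter_upwards [(lintegral_eq_zero_iff (by fun_prop)).1 h] with η hη
    have h1 : hGradNorm w η ^ (2 * n + 2) ≤ 0 := ENNReal.ofReal_eq_zero.1 hη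
    have h2 : hGradNorm w η = 0 :=
      pow_eq_zero_iff (by omega) |>.1 (le_antisymm h1 (pow_nonneg (Real.sqrt_nonneg _) _))
    rw [h2, ENNReal.ofReal_zero, zero_mul]
  rw [lintegral_congr_ae h0, lintegral_zero] at hrep
  have h1 := ENNReal.ofReal_eq_zero.1 (le_antisymm hrep zero_le)
  have h2 : |w ξ| ≤ 0 := by
    by_contra hpos
    have := mul_pos (sigmaQ_pos n) (not_le.1 hpos)
    linarith
  exact abs_nonpos_iff.1 h2

theorem zeta_zero_nonpos {m : ℕ} (hm : m ≠ 0) : zeta (m + 1) 0 ≤ 0 := by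
  have h := zeta_mul_le le_rfl zero_le_one (le_refl (0 : ℝ)) m
  rwa [zero_pow hm, zero_mul, zero_mul] at h

/-- Lemma 4.1 (local singular Trudinger–Moser inequality): for `0 ≤ β < Q` and
`0 ≤ α ≤ α_Q(1-β/Q)` there is a constant `C = C(n,r,β)`, independent of the center `ξ₀`,
such that the local singular Trudinger–Moser integral of any `w ∈ C_c^∞` supported in
`B_h(ξ₀,r)` with `∫_{B_h(ξ₀,r)} |∇_H w|^Q ≤ 1` is bounded by `C ∫_{B_h(ξ₀,r)} |∇_H w|^Q`. -/
theorem local_trudinger_moser_heisenberg (n : ℕ) (hn : 1 ≤ n) (r : ℝ) (hr : 0 < r)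
    (β α : ℝ) (hβ0 : 0 ≤ β) (hβ : β < 2 * n + 2)
    (hα0 : 0 ≤ α) (hα : α ≤ alphaQ n * (1 - β / (2 * n + 2))) :
    ∃ C : ℝ, 0 < C ∧ ∀ ξ₀ : Heis n, ∀ w : Heis n → ℝ,
      ContDiff ℝ (⊤ : ℕ∞) w → HasCompactSupport w → (∀ ξ, ξ ∉ hBall ξ₀ r → w ξ = 0) →
      (∫⁻ ξ in hBall ξ₀ r, ENNReal.ofReal (hGradNorm w ξ ^ (2 * n + 2)) ≤ 1) →
      ∫⁻ ξ in hBall ξ₀ r, ENNReal.ofReal ((hNorm ξ) ^ (-β) *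
          zeta (2 * n + 2) (α * |w ξ| ^ ((2 * (n : ℝ) + 2) / (2 * n + 1)))) ≤
        ENNReal.ofReal C *
          ∫⁻ ξ in hBall ξ₀ r, ENNReal.ofReal (hGradNorm w ξ ^ (2 * n + 2)) := by
  obtain ⟨C, hC, hbound⟩ := exists_normalized_bound hn hr hβ0 hβ
  refine ⟨C + 1, by positivity, fun ξ₀ w hw hc hw0 hI => ?_⟩
  have hw1 : ContDiff ℝ 1 w := hw.of_le (by exact_mod_cast le_top)
  have hf : Measurable (hGradNorm w) := (continuous_hGradNorm hw1).measurable
  have hf0 : ∀ ξ, 0 ≤ hGradNorm w ξ := fun ξ => Real.sqrt_nonneg _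
  have hfout := fun ξ (hξ : ξ ∉ hBall ξ₀ r) =>
    hGradNorm_eq_zero_of_notMem_hBall hw1 hr hw0 hξ
  have hIfull : ∫⁻ ξ in hBall ξ₀ r, ENNReal.ofReal (hGradNorm w ξ ^ (2 * n + 2)) =
      ∫⁻ ξ, ENNReal.ofReal (hGradNorm w ξ ^ (2 * n + 2)) := by
    rw [← lintegral_indicator (measurableSet_hBall ξ₀ r)]
    refine lintegral_congr fun ξ => Set.indicator_apply_eq_self.2 fun hξ => ?_
    rw [hfout ξ hξ, zero_pow (by omega), ENNReal.ofReal_zero]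
  set J : ℝ := (∫⁻ ξ in hBall ξ₀ r, ENNReal.ofReal (hGradNorm w ξ ^ (2 * n + 2))).toReal with hJ
  have hJI : ∫⁻ ξ in hBall ξ₀ r, ENNReal.ofReal (hGradNorm w ξ ^ (2 * n + 2)) =
      ENNReal.ofReal J := (ENNReal.ofReal_toReal (hI.trans_lt ENNReal.one_lt_top).ne).symm
  have hJ1 : J ≤ 1 := ENNReal.toReal_le_of_le_ofReal zero_le_one (by simpa using hI)
  have hQ : (0 : ℝ) < 2 * n + 2 := by positivity
  have hQ1 : (0 : ℝ) < 2 * n + 1 := by positivity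
  have hJnonneg : 0 ≤ J := ENNReal.toReal_nonneg
  rcases hJnonneg.eq_or_lt with hJ0 | hJpos
  · have hI0 : ∫⁻ ξ, ENNReal.ofReal (hGradNorm w ξ ^ (2 * n + 2)) = 0 := by
      rw [← hIfull, hJI, ← hJ0, ENNReal.ofReal_zero]
    have hz : ∀ ξ, ENNReal.ofReal ((hNorm ξ) ^ (-β) *
        zeta (2 * n + 2) (α * |w ξ| ^ ((2 * (n : ℝ) + 2) / (2 * n + 1)))) = 0 := by
      intro ξ
      rw [eq_zero_of_lintegral_hGradNorm_eq_zero hn hw1 hc hI0 ξ, abs_zero,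
        Real.zero_rpow (by positivity), mul_zero]
      exact ENNReal.ofReal_of_nonpos (mul_nonpos_of_nonneg_of_nonpos
        (Real.rpow_nonneg (hNorm_nonneg ξ) _) (zeta_zero_nonpos (by omega)))
    simp [hz]
  set a : ℝ := J ^ (-(1 / (2 * n + 2 : ℝ))) with ha
  have hapos : 0 < a := Real.rpow_pos_of_pos hJpos _
  have haQ : a ^ (2 * n + 2) = J⁻¹ := by
    rw [ha, ← Real.rpow_natCast, ← Real.rpow_mul hJpos.le, ← Real.rpow_neg_one]
    congr 1
    push_cast
    field_simp
  have hb := hbound ξ₀ (fun ξ => a * hGradNorm w ξ) (fun ξ => a * w ξ) (by fun_prop)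
    (hw1.continuous.measurable.const_mul a) (fun ξ => mul_nonneg hapos.le (hf0 ξ))
    (fun ξ hξ => by rw [hfout ξ hξ, mul_zero]) ?_ fun ξ => ?_
  · have hpt : ∀ ξ, ENNReal.ofReal ((hNorm ξ) ^ (-β) *
        zeta (2 * n + 2) (α * |w ξ| ^ ((2 * (n : ℝ) + 2) / (2 * n + 1)))) ≤
        ENNReal.ofReal J * (ENNReal.ofReal (hNorm ξ ^ (-β)) * ENNReal.ofReal (Real.exp
        ((1 - β / (2 * n + 2)) *
          (alphaQ n * |a * w ξ| ^ ((2 * (n : ℝ) + 2) / (2 * n + 1)))))) := by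
      intro ξ
      have hh := Real.rpow_nonneg (hNorm_nonneg ξ) (-β)
      rw [← ENNReal.ofReal_mul hh, ← ENNReal.ofReal_mul hJpos.le, mul_left_comm J]
      refine ENNReal.ofReal_le_ofReal (mul_le_mul_of_nonneg_left ?_ hh)
      set q : ℝ := (2 * (n : ℝ) + 2) / (2 * n + 1) with hq
      set c : ℝ := J ^ (1 / (2 * n + 1 : ℝ)) with hc'
      have hc0 : 0 ≤ c := Real.rpow_nonneg hJpos.le _
      have hc1 : c ≤ 1 := Real.rpow_le_one hJpos.le hJ1 (by positivity)
      have hcJ : c ^ (2 * n + 1) = J := by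
        rw [hc', ← Real.rpow_natCast, ← Real.rpow_mul hJpos.le]
        push_cast
        rw [one_div_mul_cancel hQ1.ne', Real.rpow_one]
      have hca : c * a ^ q = 1 := by
        rw [hc', ha, ← Real.rpow_mul hJpos.le, ← Real.rpow_add hJpos, hq,
          ← Real.rpow_zero J]
        congr 1
        field_simp
        ring
      have hu : 0 ≤ |a * w ξ| ^ q := Real.rpow_nonneg (abs_nonneg _) _
      have hs : α * |w ξ| ^ q = c * (α * |a * w ξ| ^ q) := by
        rw [abs_mul, abs_of_pos hapos, Real.mul_rpow hapos.le (abs_nonneg _)]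
        linear_combination (-(α * |w ξ| ^ q)) * hca
      calc zeta (2 * n + 2) (α * |w ξ| ^ q)
          ≤ c ^ (2 * n + 1) * zeta (2 * n + 2) (α * |a * w ξ| ^ q) := by
            rw [hs]
            exact zeta_mul_le hc0 hc1 (mul_nonneg hα0 hu) (2 * n + 1)
        _ ≤ J * Real.exp (α * |a * w ξ| ^ q) := by
            rw [hcJ]
            exact mul_le_mul_of_nonneg_left (zeta_le_exp (mul_nonneg hα0 hu) _) hJpos.le
        _ ≤ J * Real.exp ((1 - β / (2 * n + 2)) * (alphaQ n * |a * w ξ| ^ q)) := by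
            refine mul_le_mul_of_nonneg_left (Real.exp_le_exp.2 ?_) hJpos.le
            calc α * |a * w ξ| ^ q ≤ alphaQ n * (1 - β / (2 * n + 2)) * |a * w ξ| ^ q :=
                  mul_le_mul_of_nonneg_right hα hu
              _ = _ := by ring
    refine (lintegral_mono hpt).trans ?_
    rw [lintegral_const_mul' _ _ ENNReal.ofReal_ne_top, hJI, mul_comm (ENNReal.ofReal (C + 1))]
    refine mul_le_mul_right (hb.trans (ENNReal.ofReal_le_ofReal (by linarith))) _
  · have e : ∀ ξ, ENNReal.ofReal ((a * hGradNorm w ξ) ^ (2 * n + 2)) =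
        ENNReal.ofReal J⁻¹ * ENNReal.ofReal (hGradNorm w ξ ^ (2 * n + 2)) := by
      intro ξ
      rw [mul_pow, haQ, ENNReal.ofReal_mul (by positivity)]
    rw [lintegral_congr e, lintegral_const_mul' _ _ ENNReal.ofReal_ne_top, ← hIfull, hJI,
      ← ENNReal.ofReal_mul (by positivity), inv_mul_cancel₀ hJpos.ne', ENNReal.ofReal_one]
  · have hrep := mul_le_mul_right (sigmaQ_mul_abs_le_lintegral hn hw1 hc ξ) (ENNReal.ofReal a)
    rw [← lintegral_const_mul' _ _ ENNReal.ofReal_ne_top, ← ENNReal.ofReal_mul hapos.le] at hrep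
    refine (le_of_eq ?_).trans (hrep.trans_eq (lintegral_congr fun η => ?_))
    · rw [abs_mul, abs_of_pos hapos, mul_left_comm]
    · rw [← mul_assoc, ← ENNReal.ofReal_mul hapos.le]
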